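/- arXiv:1811.01212 — 2 statements merged into one kernel-verified Lean document; each statement's English description precedes it below -/
import Mathlib

section
/- Let D ⊂ ℝ^N be a closed set. Then for all t ∈ ℝ: P( min_{w ∈ D} C_λ(w) ≤ t ) ≤ 2 P( min_{w ∈ D} L_λ(w) ≤ t ). If moreover D is convex and closed, then for all t ∈ ℝ: P( min_{w ∈ D} C_λ(w) ≥ t ) ≤ 2 P( min_{w ∈ D} L_λ(w) ≥ t ). -/
open MeasureTheory ProbabilityTheory
open scoped ENNReal NNReal

noncomputable section

/-- Standard Gaussian density φ. -/
def gphi (x : ℝ) : ℝ := Real.exp (-x ^ 2 / 2) / Real.sqrt (2 * Real.pi)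

/-- Standard Gaussian CDF Φ. -/
def gPhi (x : ℝ) : ℝ := ∫ t in Set.Iic x, gphi t

/-- Soft thresholding η(x; b) = sign(x)(|x| − b)₊. -/
def eta (x b : ℝ) : ℝ := Real.sign x * max (|x| - b) 0

/-- Derivative in x of soft thresholding: η′(x; b) = 1_{|x| > b}. -/
def eta' (x b : ℝ) : ℝ := if b < |x| then 1 else 0

/-- The ℓ_p ball F_p(ξ) = {x : (1/N) ∑ |xᵢ|^p ≤ ξ^p}. -/
def Fball (N : ℕ) (p ξ : ℝ) : Set (Fin N → ℝ) :=
  {x | (1 / (N : ℝ)) * ∑ i, |x i| ^ p ≤ ξ ^ p}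

/-- Number of nonzero entries ‖x‖₀. -/
def l0 {N : ℕ} (x : Fin N → ℝ) : ℕ := (Finset.univ.filter fun i => x i ≠ 0).card

/-- The ℓ₀ ball F_0(s) = {x : ‖x‖₀ ≤ sN}. -/
def F0ball (N : ℕ) (s : ℝ) : Set (Fin N → ℝ) := {x | (l0 x : ℝ) ≤ s * N}

/-- The critical sparsity s_max(δ). -/
def smax (δ : ℝ) : ℝ :=
  δ * sSup ((fun α : ℝ =>
      (1 - (2 / δ) * ((1 + α ^ 2) * gPhi (-α) - α * gphi α)) /
      (1 + α ^ 2 - 2 * ((1 + α ^ 2) * gPhi (-α) - α * gphi α))) '' Set.Ici 0)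

/-- Empirical distribution of the entries of a vector. -/
def empDist {N : ℕ} (θ : Fin N → ℝ) : Measure ℝ :=
  ((N : ℝ≥0∞))⁻¹ • ∑ i : Fin N, Measure.dirac (θ i)

/-- Empirical distribution of pairs of entries of two vectors. -/
def empDist2 {N : ℕ} (u v : Fin N → ℝ) : Measure (ℝ × ℝ) :=
  ((N : ℝ≥0∞))⁻¹ • ∑ i : Fin N, Measure.dirac (u i, v i)

/-- Squared order-2 Wasserstein distance between measures on ℝ². -/
def W2sq (μ ν : Measure (ℝ × ℝ)) : ℝ :=
  sInf {r : ℝ | ∃ γ : Measure ((ℝ × ℝ) × (ℝ × ℝ)),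
    γ.map Prod.fst = μ ∧ γ.map Prod.snd = ν ∧
    r = ∫ q, ((q.1.1 - q.2.1) ^ 2 + (q.1.2 - q.2.2) ^ 2) ∂γ}

/-- Order-2 Wasserstein distance. -/
def W2 (μ ν : Measure (ℝ × ℝ)) : ℝ := Real.sqrt (W2sq μ ν)

/-- Standard Gaussian measure on ℝ. -/
def stdG : Measure ℝ := gaussianReal 0 1

/-- The state-evolution fixed point equations (for (Θ,Z) ∼ μ ⊗ N(0,1)),
together with positivity of (β, τ). -/
def StateEvo (δ σ : ℝ) (μ : Measure ℝ) (lam β τ : ℝ) : Prop :=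
  0 < β ∧ 0 < τ ∧
  τ ^ 2 = σ ^ 2 + (1 / δ) *
    ∫ q : ℝ × ℝ, (eta (q.1 + τ * q.2) (τ * lam / β) - q.1) ^ 2 ∂(μ.prod stdG) ∧
  β = τ * (1 - (1 / δ) *
    ∫ q : ℝ × ℝ, eta' (q.1 + τ * q.2) (τ * lam / β) ∂(μ.prod stdG))

/-- s⋆ = P(|Θ + τZ| ≥ ατ) for (Θ,Z) ∼ μ ⊗ N(0,1). -/
def sStar (μ : Measure ℝ) (τ α : ℝ) : ℝ :=
  ((μ.prod stdG) {q : ℝ × ℝ | α * τ ≤ |q.1 + τ * q.2|}).toReal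

/-- The limit law μ⋆: law of (η(Θ + τZ; ατ), Θ) for (Θ,Z) ∼ μ ⊗ N(0,1). -/
def muStar (μ : Measure ℝ) (τ α : ℝ) : Measure (ℝ × ℝ) :=
  (μ.prod stdG).map (fun q => (eta (q.1 + τ * q.2) (α * τ), q.1))

/-- The limit law for the debiased Lasso: law of (Θ + τZ, Θ). -/
def muStarD (μ : Measure ℝ) (τ : ℝ) : Measure (ℝ × ℝ) :=
  (μ.prod stdG).map (fun q => (q.1 + τ * q.2, q.1))

/-- Law of the design matrix: i.i.d. N(0, 1/n) entries. -/
def PX (n N : ℕ) : Measure (Fin n → Fin N → ℝ) :=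
  Measure.pi fun _ => Measure.pi fun _ => gaussianReal 0 ((n : ℝ≥0))⁻¹

/-- Law of the noise: i.i.d. standard Gaussian entries. -/
def Pz (n : ℕ) : Measure (Fin n → ℝ) :=
  Measure.pi fun _ => gaussianReal 0 1

/-- Joint law of (X, z). -/
def Pmodel (n N : ℕ) : Measure ((Fin n → Fin N → ℝ) × (Fin n → ℝ)) :=
  (PX n N).prod (Pz n)

/-- The response y = Xθ⋆ + σz. -/
def yvec {n N : ℕ} (σ : ℝ) (θstar : Fin N → ℝ) (X : Fin n → Fin N → ℝ)
    (z : Fin n → ℝ) : Fin n → ℝ :=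
  fun i => (∑ j, X i j * θstar j) + σ * z i

/-- The Lasso cost (1/(2n))‖y − Xθ‖² + (λ/n)‖θ‖₁. -/
def lassoCost {n N : ℕ} (X : Fin n → Fin N → ℝ) (y : Fin n → ℝ) (lam : ℝ)
    (θ : Fin N → ℝ) : ℝ :=
  (1 / (2 * (n : ℝ))) * ∑ i, (y i - ∑ j, X i j * θ j) ^ 2
    + (lam / (n : ℝ)) * ∑ j, |θ j|

/-- The uniformity class: D is either an ℓ_p ball F_p(ξ) or an ℓ₀ ball F_0(s) with
s below the critical sparsity, with the corresponding exponent q. -/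
def DFamSpec (δ : ℝ) (Dfam : (M : ℕ) → Set (Fin M → ℝ)) (q : ℝ) : Prop :=
  (∃ p ξ : ℝ, 0 < p ∧ 0 < ξ ∧ (∀ M, Dfam M = Fball M p ξ) ∧ q = max (1 / p - 1) 0) ∨
  (∃ s : ℝ, 0 ≤ s ∧ s < smax δ ∧ (∀ M, Dfam M = F0ball M s) ∧ q = 0)

/-- The Lasso cost in the shifted variable w = θ − θ⋆:
C_λ(w) = (1/(2n))‖Xw − σz‖² + (λ/n)(‖w + θ⋆‖₁ − ‖θ⋆‖₁). -/
def shiftedCost (n N : ℕ) (σ lam : ℝ) (θstar : Fin N → ℝ)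
    (X : Fin n → Fin N → ℝ) (z : Fin n → ℝ) (w : Fin N → ℝ) : ℝ :=
  (1 / (2 * (n : ℝ))) * ∑ i, ((∑ j, X i j * w j) - σ * z i) ^ 2
    + (lam / (n : ℝ)) * (∑ j, |w j + θstar j| - ∑ j, |θstar j|)

/-- Gordon's auxiliary cost L_λ(w). -/
def gordonL (n N : ℕ) (σ lam : ℝ) (θstar : Fin N → ℝ)
    (g : Fin N → ℝ) (h : Fin n → ℝ) (g' : ℝ) (w : Fin N → ℝ) : ℝ :=
  (1 / 2) * (max (Real.sqrt ((∑ j, (w j) ^ 2) / (n : ℝ) + σ ^ 2)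
        * Real.sqrt (∑ i, (h i) ^ 2) / Real.sqrt (n : ℝ)
      - (1 / (n : ℝ)) * ∑ j, g j * w j + g' * σ / Real.sqrt (n : ℝ)) 0) ^ 2
    + (lam / (n : ℝ)) * (∑ j, |w j + θstar j| - ∑ j, |θstar j|)

/-- Joint law of the independent standard Gaussians (g, h, g′). -/
def Pgordon (n N : ℕ) : Measure ((Fin N → ℝ) × ((Fin n → ℝ) × ℝ)) :=
  (Measure.pi fun _ : Fin N => gaussianReal 0 1).prod
    ((Measure.pi fun _ : Fin n => gaussianReal 0 1).prod (gaussianReal 0 1))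

section GordonComparison

open Filter Topology

/-- `F x y = O(‖y‖ ^ k)`, uniformly in `x` and globally in `y`. -/
def UniformOrder {E : Type*} [Norm E] (k : ℕ) (F : E → E → ℝ) : Prop :=
  ∃ C : ℝ, ∀ x y, |F x y| ≤ C * ‖y‖ ^ k

namespace UniformOrder

variable {E : Type*} [SeminormedAddCommGroup E] {k l : ℕ} {F F' : E → E → ℝ}

lemma neg (h : UniformOrder k F) : UniformOrder k (fun x y => -F x y) := by
  simpa [UniformOrder] using h

lemma add (h : UniformOrder k F) (h' : UniformOrder k F') :
    UniformOrder k (fun x y => F x y + F' x y) := by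
  obtain ⟨C, hC⟩ := h
  obtain ⟨C', hC'⟩ := h'
  refine ⟨C + C', fun x y => (abs_add_le _ _).trans ?_⟩
  rw [add_mul]
  exact add_le_add (hC x y) (hC' x y)

lemma mul (h : UniformOrder k F) (h' : UniformOrder l F') :
    UniformOrder (k + l) (fun x y => F x y * F' x y) := by
  obtain ⟨C, hC⟩ := h
  obtain ⟨C', hC'⟩ := h'
  refine ⟨C * C', fun x y => ?_⟩
  rw [abs_mul, pow_add, mul_mul_mul_comm]
  exact mul_le_mul (hC x y) (hC' x y) (abs_nonneg _) ((abs_nonneg _).trans (hC x y))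

lemma translate {f : E → ℝ} (h : UniformOrder 0 (fun x _ => f x)) :
    UniformOrder 0 (fun x y => f (x + y)) := by
  obtain ⟨C, hC⟩ := h
  exact ⟨C, fun x y => by simpa using hC (x + y) 0⟩

lemma congr (h : UniformOrder k F) (hF : ∀ x y, F x y = F' x y) : UniformOrder k F' := by
  obtain ⟨C, hC⟩ := h
  exact ⟨C, fun x y => hF x y ▸ hC x y⟩

end UniformOrder

section Jets

variable {ι : Type*} [Fintype ι]

/-- The linear form with coefficients `G · x`. -/
def jetLin (G : ι → (ι → ℝ) → ℝ) (x y : ι → ℝ) : ℝ := ∑ a, G a x * y a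

/-- The quadratic form with coefficients `H · · x`. -/
def jetQuad (H : ι → ι → (ι → ℝ) → ℝ) (x y : ι → ℝ) : ℝ := ∑ a, ∑ b, H a b x * (y a * y b)

/-- `f` is a bounded continuous function with the second order expansion
`f (x + y) = f x + ∑ a, G a x * y a + ∑ a, ∑ b, H a b x * (y a * y b) + O(‖y‖ ^ 3)`,
uniformly in `x`. -/
structure HasBoundedJet (f : (ι → ℝ) → ℝ) (G : ι → (ι → ℝ) → ℝ)
    (H : ι → ι → (ι → ℝ) → ℝ) : Prop where
  continuous : Continuous f
  bounded : UniformOrder 0 (fun x (_ : ι → ℝ) => f x)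
  lin : UniformOrder 1 (jetLin G)
  quad : UniformOrder 2 (jetQuad H)
  taylor_zero : UniformOrder 1 (fun x y => f (x + y) - f x)
  taylor_one : UniformOrder 2 (fun x y => f (x + y) - f x - jetLin G x y)
  taylor_two : UniformOrder 3 (fun x y => f (x + y) - f x - jetLin G x y - jetQuad H x y)

namespace HasBoundedJet

variable {f g : (ι → ℝ) → ℝ} {G G' : ι → (ι → ℝ) → ℝ} {H H' : ι → ι → (ι → ℝ) → ℝ}

lemma const (c : ℝ) : HasBoundedJet (fun _ : ι → ℝ => c) (fun _ _ => 0) (fun _ _ _ => 0) where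
  continuous := continuous_const
  bounded := ⟨|c|, by simp⟩
  lin := ⟨0, by simp [jetLin]⟩
  quad := ⟨0, by simp [jetQuad]⟩
  taylor_zero := ⟨0, by simp⟩
  taylor_one := ⟨0, by simp [jetLin]⟩
  taylor_two := ⟨0, by simp [jetLin, jetQuad]⟩

lemma one_sub (h : HasBoundedJet f G H) :
    HasBoundedJet (fun x => 1 - f x) (fun a x => -G a x) (fun a b x => -H a b x) := by
  have hL : ∀ x y, jetLin (fun a x => -G a x) x y = -jetLin G x y := by simp [jetLin]
  have hQ : ∀ x y, jetQuad (fun a b x => -H a b x) x y = -jetQuad H x y := by simp [jetQuad]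
  refine ⟨continuous_const.sub h.continuous, ?_, ?_, ?_, ?_, ?_, ?_⟩
  · exact ((const (ι := ι) 1).bounded.add h.bounded.neg).congr fun x y => by ring
  · exact h.lin.neg.congr fun x y => (hL x y).symm
  · exact h.quad.neg.congr fun x y => (hQ x y).symm
  · exact h.taylor_zero.neg.congr fun x y => by ring
  · exact h.taylor_one.neg.congr fun x y => by rw [hL]; ring
  · exact h.taylor_two.neg.congr fun x y => by rw [hL, hQ]; ring

lemma mul (hf : HasBoundedJet f G H) (hg : HasBoundedJet g G' H') :
    HasBoundedJet (fun x => f x * g x) (fun a x => f x * G' a x + g x * G a x)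
      (fun a b x => f x * H' a b x + g x * H a b x + G a x * G' b x) := by
  have hL : ∀ x y, jetLin (fun a x => f x * G' a x + g x * G a x) x y
      = f x * jetLin G' x y + g x * jetLin G x y := by
    intro x y
    simp only [jetLin, Finset.mul_sum, ← Finset.sum_add_distrib]
    exact Finset.sum_congr rfl fun _ _ => by ring
  have hQ : ∀ x y, jetQuad (fun a b x => f x * H' a b x + g x * H a b x + G a x * G' b x) x y
      = f x * jetQuad H' x y + g x * jetQuad H x y + jetLin G x y * jetLin G' x y := by
    intro x y
    simp only [jetLin, jetQuad]
    rw [Finset.sum_mul_sum]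
    simp only [Finset.mul_sum, ← Finset.sum_add_distrib]
    exact Finset.sum_congr rfl fun _ _ => Finset.sum_congr rfl fun _ _ => by ring
  refine ⟨hf.continuous.mul hg.continuous, hf.bounded.mul hg.bounded, ?_, ?_, ?_, ?_, ?_⟩
  · exact ((hf.bounded.mul hg.lin).add (hg.bounded.mul hf.lin)).congr fun x y => (hL x y).symm
  · exact (((hf.bounded.mul hg.quad).add (hg.bounded.mul hf.quad)).add
      (hf.lin.mul hg.lin)).congr fun x y => (hQ x y).symm
  · exact ((hf.bounded.translate.mul hg.taylor_zero).add (hg.bounded.mul hf.taylor_zero)).congr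
      fun x y => by ring
  · refine (((hf.bounded.translate.mul hg.taylor_one).add (hg.bounded.mul hf.taylor_one)).add
      (hf.taylor_zero.mul hg.lin)).congr fun x y => ?_
    rw [hL]; ring
  · refine ((((hf.bounded.translate.mul hg.taylor_two).add (hg.bounded.mul hf.taylor_two)).add
      (hf.taylor_one.mul hg.lin)).add (hf.taylor_zero.mul hg.quad)).congr fun x y => ?_
    rw [hL, hQ]; ring

end HasBoundedJet

lemma abs_le_pow_succ_of_hasDerivAt {g g' : ℝ → ℝ} {C : ℝ} {k : ℕ} (hg0 : g 0 = 0)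
    (hg : ∀ v, HasDerivAt g (g' v) v) (hg' : ∀ v, |g' v| ≤ C * |v| ^ k) (v : ℝ) :
    |g v| ≤ C * |v| ^ (k + 1) := by
  have hC : 0 ≤ C := by simpa using (abs_nonneg _).trans (hg' 1)
  have h := (convex_segment (0 : ℝ) v).norm_image_sub_le_of_norm_hasDerivWithin_le
    (f := g) (f' := g') (C := C * |v| ^ k) (fun x _ => (hg x).hasDerivWithinAt)
    (fun x hx => by
      refine (hg' x).trans ?_
      have : |x| ≤ |v| := by
        obtain ⟨a, b, ha, hb, hab, rfl⟩ := hx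
        simp only [smul_eq_mul, mul_zero, zero_add, abs_mul, abs_of_nonneg hb]
        exact mul_le_of_le_one_left (abs_nonneg _) (by linarith)
      gcongr)
    (left_mem_segment ℝ 0 v) (right_mem_segment ℝ 0 v)
  simpa [hg0, pow_succ, mul_assoc] using h

lemma HasBoundedJet.eval [DecidableEq ι] {T T₁ T₂ T₃ : ℝ → ℝ} {C : ℝ}
    (h₁ : ∀ u, HasDerivAt T (T₁ u) u)
    (h₂ : ∀ u, HasDerivAt T₁ (T₂ u) u) (h₃ : ∀ u, HasDerivAt T₂ (T₃ u) u)
    (b₀ : ∀ u, |T u| ≤ C) (b₁ : ∀ u, |T₁ u| ≤ C) (b₂ : ∀ u, |T₂ u| ≤ C)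
    (b₃ : ∀ u, |T₃ u| ≤ C) (p : ι) :
    HasBoundedJet (fun x : ι → ℝ => T (x p)) (fun a x => if a = p then T₁ (x p) else 0)
      (fun a b x => if a = p ∧ b = p then T₂ (x p) / 2 else 0) := by
  have hC : 0 ≤ C := (abs_nonneg _).trans (b₀ 0)
  have shift : ∀ {S S' : ℝ → ℝ}, (∀ u, HasDerivAt S (S' u) u) → ∀ u v,
      HasDerivAt (fun v => S (u + v)) (S' (u + v)) v := fun hS u v => by
    simpa using (hS (u + v)).comp_const_add u v
  have t0 : ∀ {S S' : ℝ → ℝ}, (∀ u, HasDerivAt S (S' u) u) → (∀ u, |S' u| ≤ C) → ∀ u v,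
      |S (u + v) - S u| ≤ C * |v| ^ 1 := fun {S S'} hS hb u v =>
    abs_le_pow_succ_of_hasDerivAt (k := 0) (g := fun v => S (u + v) - S u) (by simp)
      (fun v => (shift hS u v).sub_const _) (fun v => by simpa using hb (u + v)) v
  have t1 : ∀ {S S' S'' : ℝ → ℝ}, (∀ u, HasDerivAt S (S' u) u) → (∀ u, HasDerivAt S' (S'' u) u) →
      (∀ u, |S'' u| ≤ C) → ∀ u v, |S (u + v) - S u - S' u * v| ≤ C * |v| ^ 2 :=
    fun {S S' S''} hS hS' hb u v =>
    abs_le_pow_succ_of_hasDerivAt (k := 1) (g := fun v => S (u + v) - S u - S' u * v) (by simp)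
      (g' := fun v => S' (u + v) - S' u)
      (fun v => by
        simpa using ((shift hS u v).sub_const (S u)).fun_sub
          ((hasDerivAt_id v).const_mul (S' u)))
      (t0 hS' hb u) v
  have t2 : ∀ u v, |T (u + v) - T u - T₁ u * v - T₂ u / 2 * (v * v)| ≤ C * |v| ^ 3 := fun u v =>
    abs_le_pow_succ_of_hasDerivAt (k := 2)
      (g := fun v => T (u + v) - T u - T₁ u * v - T₂ u / 2 * (v * v)) (by simp)
      (g' := fun v => T₁ (u + v) - T₁ u - T₂ u * v)
      (fun v => by
        have := (((shift h₁ u v).sub_const (T u)).fun_sub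
          ((hasDerivAt_id' v).const_mul (T₁ u))).fun_sub
          (((hasDerivAt_id' v).fun_mul (hasDerivAt_id' v)).const_mul (T₂ u / 2))
        exact this.congr_deriv (by ring))
      (t1 h₂ h₃ b₃ u) v
  have hL : ∀ x y, jetLin (fun a x => if a = p then T₁ (x p) else 0) x y = T₁ (x p) * y p := by
    intro x y; simp [jetLin]
  have hQ : ∀ x y, jetQuad (fun a b x => if a = p ∧ b = p then T₂ (x p) / 2 else 0) x y
      = T₂ (x p) / 2 * (y p * y p) := by
    intro x y
    simp only [jetQuad]
    rw [Finset.sum_eq_single p, Finset.sum_eq_single p] <;> simp +contextual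
  have key : ∀ {k : ℕ} {F : ℝ → ℝ → ℝ}, (∀ u v, |F u v| ≤ C * |v| ^ k) →
      UniformOrder k (fun x y : ι → ℝ => F (x p) (y p)) := fun {k F} hF =>
    ⟨C, fun x y => (hF _ _).trans (by gcongr; exact norm_le_pi_norm y p)⟩
  refine ⟨?_, ?_, ?_, ?_, ?_, ?_, ?_⟩
  · exact (continuous_iff_continuousAt.2 fun u => (h₁ u).continuousAt).comp (continuous_apply p)
  · exact key (F := fun u _ => T u) (k := 0) (by simpa using b₀)
  · refine (key (k := 1) (F := fun u v => T₁ u * v) fun u v => ?_).congr fun x y => (hL x y).symm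
    rw [abs_mul, pow_one]; gcongr; exact b₁ u
  · refine (key (k := 2) (F := fun u v => T₂ u / 2 * (v * v)) fun u v => ?_).congr
      fun x y => (hQ x y).symm
    rw [abs_mul, abs_mul, ← sq]
    gcongr
    rw [abs_div, abs_two]
    linarith [b₂ u, abs_nonneg (T₂ u)]
  · exact key (k := 1) (F := fun u v => T (u + v) - T u) (t0 h₁ b₁)
  · exact (key (k := 2) (F := fun u v => T (u + v) - T u - T₁ u * v) (t1 h₁ h₂ b₂)).congr
      fun x y => by rw [hL]; rfl
  · exact (key (k := 3) (F := fun u v => T (u + v) - T u - T₁ u * v - T₂ u / 2 * (v * v)) t2).congr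
      fun x y => by rw [hL, hQ]; rfl

end Jets

/-- A smooth nonincreasing function, equal to `1` on `(-∞, l]` and to `0` on `[l + c⁻¹, ∞)`. -/
def smoothCutoff (c l u : ℝ) : ℝ := 1 - Real.smoothTransition (c * (u - l))

lemma smoothCutoff_nonneg (c l u : ℝ) : 0 ≤ smoothCutoff c l u :=
  sub_nonneg.2 (Real.smoothTransition.le_one _)

lemma smoothCutoff_le_one (c l u : ℝ) : smoothCutoff c l u ≤ 1 :=
  sub_le_self _ (Real.smoothTransition.nonneg _)

lemma tendsto_smoothCutoff (l u : ℝ) :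
    Tendsto (fun m : ℕ => smoothCutoff m l u) atTop (𝓝 (if u ≤ l then 1 else 0)) := by
  refine tendsto_const_nhds.congr' ?_
  split_ifs with h
  · refine Eventually.of_forall fun m => ?_
    beta_reduce
    unfold smoothCutoff
    rw [Real.smoothTransition.zero_of_nonpos, sub_zero]
    exact mul_nonpos_of_nonneg_of_nonpos (Nat.cast_nonneg m) (by linarith)
  · have hul : 0 < u - l := by linarith
    filter_upwards [(tendsto_natCast_atTop_atTop (R := ℝ)).eventually_ge_atTop (u - l)⁻¹]
      with m hm
    unfold smoothCutoff
    rw [Real.smoothTransition.one_of_one_le, sub_self]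
    calc (1 : ℝ) = (u - l)⁻¹ * (u - l) := (inv_mul_cancel₀ hul.ne').symm
      _ ≤ m * (u - l) := by gcongr

lemma exists_smoothTransition_derivs : ∃ s₁ s₂ s₃ : ℝ → ℝ, ∃ C : ℝ,
    (∀ u, HasDerivAt Real.smoothTransition (s₁ u) u) ∧ (∀ u, HasDerivAt s₁ (s₂ u) u) ∧
    (∀ u, HasDerivAt s₂ (s₃ u) u) ∧ (∀ u, 0 ≤ s₁ u) ∧
    (∀ u, |s₁ u| ≤ C) ∧ (∀ u, |s₂ u| ≤ C) ∧ (∀ u, |s₃ u| ≤ C) := by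
  have hst : ContDiff ℝ (2 + 1) Real.smoothTransition :=
    (Real.smoothTransition.contDiff (n := 3)).of_le (by norm_num)
  have h₁ : ContDiff ℝ (1 + 1) (deriv Real.smoothTransition) := hst.deriv'.of_le (by norm_num)
  have h₂ : ContDiff ℝ (0 + 1) (deriv (deriv Real.smoothTransition)) :=
    h₁.deriv'.of_le (by norm_num)
  have h₃ : ContDiff ℝ 0 (deriv (deriv (deriv Real.smoothTransition))) := h₂.deriv'
  have hsupp : HasCompactSupport (deriv Real.smoothTransition) := by
    refine HasCompactSupport.intro (isCompact_Icc (a := (0 : ℝ)) (b := 1)) fun x hx => ?_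
    rw [Set.mem_Icc, not_and_or, not_le, not_le] at hx
    rcases hx with hx | hx
    · have : Real.smoothTransition =ᶠ[𝓝 x] fun _ => 0 := by
        filter_upwards [gt_mem_nhds hx] with y hy
        exact Real.smoothTransition.zero_of_nonpos hy.le
      rw [this.deriv_eq, deriv_const]
    · have : Real.smoothTransition =ᶠ[𝓝 x] fun _ => 1 := by
        filter_upwards [lt_mem_nhds hx] with y hy
        exact Real.smoothTransition.one_of_one_le hy.le
      rw [this.deriv_eq, deriv_const]
  obtain ⟨C₁, hC₁⟩ := hsupp.exists_bound_of_continuous h₁.continuous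
  obtain ⟨C₂, hC₂⟩ := hsupp.deriv.exists_bound_of_continuous h₂.continuous
  obtain ⟨C₃, hC₃⟩ := hsupp.deriv.deriv.exists_bound_of_continuous h₃.continuous
  refine ⟨_, _, _, max C₁ (max C₂ C₃),
    fun u => (hst.differentiable (by norm_num) u).hasDerivAt,
    fun u => (h₁.differentiable (by norm_num) u).hasDerivAt,
    fun u => (h₂.differentiable (by norm_num) u).hasDerivAt,
    fun u => Real.smoothTransition.monotone.deriv_nonneg, fun u => ?_, fun u => ?_, fun u => ?_⟩
  · exact (hC₁ u).trans (le_max_left _ _)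
  · exact (hC₂ u).trans ((le_max_left _ _).trans (le_max_right _ _))
  · exact (hC₃ u).trans ((le_max_right _ _).trans (le_max_right _ _))

lemma exists_smoothCutoff_derivs {c : ℝ} (hc : 0 ≤ c) (l : ℝ) : ∃ T₁ T₂ T₃ : ℝ → ℝ, ∃ C : ℝ,
    (∀ u, HasDerivAt (smoothCutoff c l) (T₁ u) u) ∧ (∀ u, HasDerivAt T₁ (T₂ u) u) ∧
    (∀ u, HasDerivAt T₂ (T₃ u) u) ∧ (∀ u, T₁ u ≤ 0) ∧ (∀ u, |smoothCutoff c l u| ≤ C) ∧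
    (∀ u, |T₁ u| ≤ C) ∧ (∀ u, |T₂ u| ≤ C) ∧ (∀ u, |T₃ u| ≤ C) := by
  obtain ⟨s₁, s₂, s₃, C, h₁, h₂, h₃, hs₁, b₁, b₂, b₃⟩ := exists_smoothTransition_derivs
  have hC : 0 ≤ C := (abs_nonneg _).trans (b₁ 0)
  have hcomp : ∀ {S S' : ℝ → ℝ}, (∀ u, HasDerivAt S (S' u) u) → ∀ u,
      HasDerivAt (fun u => S (c * (u - l))) (c * S' (c * (u - l))) u := fun {S S'} hS u => by
    have := (hS (c * (u - l))).comp u (((hasDerivAt_id' u).sub_const l).const_mul c)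
    exact this.congr_deriv (by ring)
  have hb : ∀ {S : ℝ → ℝ} (k : ℕ), (∀ u, |S u| ≤ C) → ∀ u, |-(c ^ k * S u)| ≤ c ^ k * C :=
    fun k hS u => by
      rw [abs_neg, abs_mul, abs_of_nonneg (pow_nonneg hc k)]
      gcongr
      exact hS u
  refine ⟨fun u => -(c ^ 1 * s₁ (c * (u - l))), fun u => -(c ^ 2 * s₂ (c * (u - l))),
    fun u => -(c ^ 3 * s₃ (c * (u - l))), 1 + (c ^ 1 * C + (c ^ 2 * C + c ^ 3 * C)),
    fun u => ?_, fun u => ?_, fun u => ?_, fun u => ?_, fun u => ?_, fun u => ?_, fun u => ?_,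
    fun u => ?_⟩
  · exact ((hcomp h₁ u).const_sub 1).congr_deriv (by ring)
  · exact (((hcomp h₂ u).const_mul (c ^ 1)).fun_neg).congr_deriv (by ring)
  · exact (((hcomp h₃ u).const_mul (c ^ 2)).fun_neg).congr_deriv (by ring)
  · have := mul_nonneg (pow_nonneg hc 1) (hs₁ (c * (u - l)))
    linarith
  · rw [abs_of_nonneg (smoothCutoff_nonneg c l u)]
    have := smoothCutoff_le_one c l u
    have : 0 ≤ c ^ 1 * C + (c ^ 2 * C + c ^ 3 * C) := by positivity
    linarith
  · refine (hb 1 b₁ _).trans ?_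
    have : 0 ≤ c ^ 2 * C + c ^ 3 * C := by positivity
    linarith
  · refine (hb 2 b₂ _).trans ?_
    have : 0 ≤ c ^ 1 * C + c ^ 3 * C := by positivity
    linarith
  · refine (hb 3 b₃ _).trans ?_
    have : 0 ≤ c ^ 1 * C + c ^ 2 * C := by positivity
    linarith

lemma prod_smoothCutoff_le_one {A B : Type*} [Fintype B] (c : ℝ) (l : A → B → ℝ)
    (x : A × B → ℝ) (a : A) :
    ∏ b, smoothCutoff c (l a b) (x (a, b)) ≤ 1 :=
  Finset.prod_le_one (fun _ _ => smoothCutoff_nonneg _ _ _) fun _ _ => smoothCutoff_le_one _ _ _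

section MinMax

variable {A B : Type*} [Fintype A] [Fintype B]

/-- A smooth approximation of the indicator of `{x | ∀ a, ∃ b, l a b < x (a, b)}`. -/
def smoothMinMax (c : ℝ) (l : A → B → ℝ) (x : A × B → ℝ) : ℝ :=
  ∏ a, (1 - ∏ b, smoothCutoff c (l a b) (x (a, b)))

lemma smoothMinMax_nonneg (c : ℝ) (l : A → B → ℝ) (x : A × B → ℝ) : 0 ≤ smoothMinMax c l x :=
  Finset.prod_nonneg fun a _ => sub_nonneg.2 (prod_smoothCutoff_le_one c l x a)

lemma smoothMinMax_le_one (c : ℝ) (l : A → B → ℝ) (x : A × B → ℝ) : smoothMinMax c l x ≤ 1 :=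
  Finset.prod_le_one (fun a _ => sub_nonneg.2 (prod_smoothCutoff_le_one c l x a)) fun _ _ =>
    sub_le_self _ (Finset.prod_nonneg fun _ _ => smoothCutoff_nonneg _ _ _)

lemma tendsto_smoothMinMax (l : A → B → ℝ) (x : A × B → ℝ) :
    Tendsto (fun m : ℕ => smoothMinMax m l x) atTop
      (𝓝 ({x : A × B → ℝ | ∀ a, ∃ b, l a b < x (a, b)}.indicator 1 x)) := by
  have h : {x : A × B → ℝ | ∀ a, ∃ b, l a b < x (a, b)}.indicator (1 : (A × B → ℝ) → ℝ) x
      = ∏ a, (1 - ∏ b, if x (a, b) ≤ l a b then 1 else 0) := by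
    simp only [Finset.prod_ite_zero, Finset.prod_const_one, Finset.mem_univ, true_imp_iff,
      Set.indicator, Set.mem_ofPred_eq, Pi.one_apply]
    by_cases hx : ∀ a, ∃ b, l a b < x (a, b)
    · rw [if_pos hx, Finset.prod_eq_one]
      intro a _
      obtain ⟨b, hb⟩ := hx a
      rw [if_neg fun h => (h b).not_gt hb, sub_zero]
    · rw [if_neg hx]
      push Not at hx
      obtain ⟨a, ha⟩ := hx
      rw [Finset.prod_eq_zero (Finset.mem_univ a)]
      rw [if_pos ha, sub_self]
  rw [h]
  exact tendsto_finsetProd _ fun a _ => tendsto_const_nhds.sub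
    (tendsto_finsetProd _ fun b _ => tendsto_smoothCutoff _ _)

variable [DecidableEq A] [DecidableEq B]

lemma exists_jet_prod_smoothCutoff {c : ℝ} (hc : 0 ≤ c) (l : A → B → ℝ) (a : A) (s : Finset B) :
    ∃ G H, HasBoundedJet (fun x : A × B → ℝ => ∏ b ∈ s, smoothCutoff c (l a b) (x (a, b))) G H ∧
      (∀ p x, G p x ≤ 0) ∧ (∀ p x, p.1 ≠ a → G p x = 0) ∧
      ∀ p q x, p.1 ≠ q.1 → H p q x = 0 := by
  induction s using Finset.induction_on with
  | empty => exact ⟨_, _, by simpa using HasBoundedJet.const 1, by simp, by simp, by simp⟩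
  | insert b s hb ih =>
    obtain ⟨G, H, hj, hG, hGa, hH⟩ := ih
    obtain ⟨T₁, T₂, T₃, C, h₁, h₂, h₃, hT, b₀, b₁, b₂, b₃⟩ := exists_smoothCutoff_derivs hc (l a b)
    refine ⟨_, _, by simpa only [Finset.prod_insert hb] using
      (HasBoundedJet.eval h₁ h₂ h₃ b₀ b₁ b₂ b₃ (a, b)).mul hj, fun p x => ?_, fun p x hp => ?_,
      fun p q x hpq => ?_⟩
    · refine add_nonpos (mul_nonpos_of_nonneg_of_nonpos (smoothCutoff_nonneg _ _ _) (hG p x))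
        (mul_nonpos_of_nonneg_of_nonpos
          (Finset.prod_nonneg fun _ _ => smoothCutoff_nonneg _ _ _) ?_)
      split_ifs
      exacts [hT _, le_rfl]
    · have : p ≠ (a, b) := fun h => hp (by rw [h])
      simp [hGa p x hp, this]
    · have h1 : ¬ (p = (a, b) ∧ q = (a, b)) := fun h => hpq (by rw [h.1, h.2])
      have h2 : p = (a, b) → G q x = 0 := fun h => hGa q x fun hq => hpq (by rw [h, hq])
      simp only [hH p q x hpq, h1, if_false, mul_zero, zero_add, ite_mul, zero_mul]
      split_ifs with h
      · rw [h2 h, mul_zero]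
      · rfl

lemma exists_jet_smoothMinMax {c : ℝ} (hc : 0 ≤ c) (l : A → B → ℝ) :
    ∃ G H, HasBoundedJet (smoothMinMax c l) G H ∧ ∀ p q x, p.1 ≠ q.1 → 0 ≤ H p q x := by
  suffices h : ∀ s : Finset A, ∃ G H, HasBoundedJet
      (fun x : A × B → ℝ => ∏ a ∈ s, (1 - ∏ b, smoothCutoff c (l a b) (x (a, b)))) G H ∧
      (∀ p x, 0 ≤ G p x) ∧ ∀ p q x, p.1 ≠ q.1 → 0 ≤ H p q x by
    obtain ⟨G, H, hj, -, hH⟩ := h Finset.univ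
    exact ⟨G, H, hj, hH⟩
  have hnn : ∀ (x : A × B → ℝ) a, 0 ≤ 1 - ∏ b, smoothCutoff c (l a b) (x (a, b)) := fun x a =>
    sub_nonneg.2 (prod_smoothCutoff_le_one c l x a)
  intro s
  induction s using Finset.induction_on with
  | empty => exact ⟨_, _, by simpa using HasBoundedJet.const 1, by simp, by simp⟩
  | insert a s ha ih =>
    obtain ⟨G, H, hj, hG, hH⟩ := ih
    obtain ⟨G', H', hj', hG', -, hH'⟩ := exists_jet_prod_smoothCutoff hc l a Finset.univ
    have hG'' : ∀ p x, 0 ≤ -G' p x := fun p x => neg_nonneg.2 (hG' p x)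
    have hprod : ∀ x : A × B → ℝ, 0 ≤ ∏ a ∈ s, (1 - ∏ b, smoothCutoff c (l a b) (x (a, b))) :=
      fun x => Finset.prod_nonneg fun a _ => hnn x a
    refine ⟨_, _, by simpa only [Finset.prod_insert ha] using hj'.one_sub.mul hj,
      fun p x => ?_, fun p q x hpq => ?_⟩
    · exact add_nonneg (mul_nonneg (hnn x a) (hG p x)) (mul_nonneg (hprod x) (hG'' p x))
    · rw [hH' p q x hpq, neg_zero, mul_zero, add_zero]
      exact add_nonneg (mul_nonneg (hnn x a) (hH p q x hpq)) (mul_nonneg (hG'' p x) (hG q x))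

end MinMax

/-- The law of `√s • x` for `x` of law `μ`. -/
def scaledMeasure {E : Type*} [NormedAddCommGroup E] [NormedSpace ℝ E] [MeasurableSpace E]
    (μ : Measure E) (s : ℝ) : Measure E :=
  μ.map (Real.sqrt s • ContinuousLinearMap.id ℝ E)

section Semigroup

variable {E : Type*} [NormedAddCommGroup E] [NormedSpace ℝ E] [MeasurableSpace E]
  {μ : Measure E}

lemma scaledMeasure_one : scaledMeasure μ 1 = μ := by
  simp [scaledMeasure]

lemma scaledMeasure_zero [IsProbabilityMeasure μ] : scaledMeasure μ 0 = Measure.dirac 0 := by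
  have : ⇑(Real.sqrt 0 • ContinuousLinearMap.id ℝ E) = fun _ => (0 : E) := by ext; simp
  rw [scaledMeasure, this, Measure.map_const, measure_univ, one_smul]

variable [BorelSpace E]

instance isProbabilityMeasure_scaledMeasure [IsProbabilityMeasure μ] (s : ℝ) :
    IsProbabilityMeasure (scaledMeasure μ s) :=
  Measure.isProbabilityMeasure_map (by fun_prop)

variable [IsGaussian μ]

lemma charFunDual_scaledMeasure (hμ : ∀ L : StrongDual ℝ E, ∫ x, L x ∂μ = 0) {s : ℝ} (hs : 0 ≤ s)
    (L : StrongDual ℝ E) :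
    charFunDual (scaledMeasure μ s) L = Complex.exp (-(s * Var[L; μ]) / 2) := by
  have hcomp : L.comp (Real.sqrt s • ContinuousLinearMap.id ℝ E) = Real.sqrt s • L := by
    ext; simp
  rw [scaledMeasure, charFunDual_map, hcomp, IsGaussian.charFunDual_eq,
    integral_complex_ofReal]
  have hmean : ∫ x, (Real.sqrt s • L) x ∂μ = 0 := by
    simp only [_root_.smul_apply, integral_smul, hμ, smul_zero]
  have : Var[⇑(Real.sqrt s • L); μ] = s * Var[L; μ] := by
    rw [show ⇑(Real.sqrt s • L) = Real.sqrt s • ⇑L from rfl, variance_smul, Real.sq_sqrt hs]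
  rw [this, hmean]
  simp [neg_div]

lemma scaledMeasure_add [SecondCountableTopology E] [CompleteSpace E]
    (hμ : ∀ L : StrongDual ℝ E, ∫ x, L x ∂μ = 0) {s t : ℝ} (hs : 0 ≤ s)
    (ht : 0 ≤ t) : scaledMeasure μ (s + t) = scaledMeasure μ s ∗ scaledMeasure μ t := by
  refine Measure.ext_of_charFunDual (funext fun L => ?_)
  rw [charFunDual_conv, charFunDual_scaledMeasure hμ (add_nonneg hs ht),
    charFunDual_scaledMeasure hμ hs, charFunDual_scaledMeasure hμ ht, ← Complex.exp_add]
  congr 1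
  push_cast
  ring

end Semigroup

section Comparison

variable {ι : Type*} [Fintype ι]

lemma integral_dual_eq_zero {μ : Measure (ι → ℝ)} [IsGaussian μ] (hμ : ∀ a, ∫ x, x a ∂μ = 0)
    (L : StrongDual ℝ (ι → ℝ)) : ∫ x, L x ∂μ = 0 := by
  classical
  have h : ∀ x, L x = ∑ a, x a * L (Pi.single a 1) := fun x => by
    conv_lhs => rw [pi_eq_sum_univ' x, map_sum]
    refine Finset.sum_congr rfl fun a _ => ?_
    rw [map_smul, smul_eq_mul]
  rw [integral_congr_ae (ae_of_all _ h), integral_finsetSum]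
  · exact Finset.sum_eq_zero fun a _ => by rw [integral_mul_const, hμ, zero_mul]
  · exact fun a _ => (IsGaussian.integrable_dual μ
      (ContinuousLinearMap.proj (R := ℝ) (φ := fun _ : ι => ℝ) a)).mul_const _

lemma integrable_coord_mul {μ : Measure (ι → ℝ)} [IsGaussian μ] (a b : ι) :
    Integrable (fun x => x a * x b) μ :=
  (IsGaussian.memLp_dual μ (ContinuousLinearMap.proj (R := ℝ) (φ := fun _ : ι => ℝ) a) 2
    (by simp)).integrable_mul (IsGaussian.memLp_dual μ
      (ContinuousLinearMap.proj (R := ℝ) (φ := fun _ : ι => ℝ) b) 2 (by simp))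

lemma HasBoundedJet.integrable {f : (ι → ℝ) → ℝ} {G H} (hf : HasBoundedJet f G H)
    (μ : Measure (ι → ℝ)) [IsFiniteMeasure μ] : Integrable f μ := by
  obtain ⟨C, hC⟩ := hf.bounded
  exact .of_bound hf.continuous.aestronglyMeasurable C
    (ae_of_all _ fun x => by simpa using hC x 0)

/-- Second order expansion of the heat semigroup of a centered Gaussian measure. -/
lemma HasBoundedJet.exists_abs_integral_scaledMeasure_sub_le {f : (ι → ℝ) → ℝ} {G H}
    (hf : HasBoundedJet f G H) (μ : Measure (ι → ℝ)) [IsGaussian μ]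
    (hμ : ∀ a, ∫ x, x a ∂μ = 0) :
    ∃ C, ∀ h, 0 ≤ h → ∀ p, |∫ x, f (p + x) ∂(scaledMeasure μ h) - f p
      - h * ∑ a, ∑ b, H a b p * ∫ x, x a * x b ∂μ| ≤ C * Real.sqrt h ^ 3 := by
  obtain ⟨C, hC⟩ := hf.taylor_two
  have h3 : Integrable (fun x : ι → ℝ => ‖x‖ ^ 3) μ :=
    (IsGaussian.memLp_id μ 3 (by simp)).integrable_norm_pow (by norm_num)
  refine ⟨C * ∫ x, ‖x‖ ^ 3 ∂μ, fun h hh p => ?_⟩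
  have hcoord : ∀ a, Integrable (fun x : ι → ℝ => x a) μ := fun a =>
    IsGaussian.integrable_dual μ (ContinuousLinearMap.proj (R := ℝ) (φ := fun _ : ι => ℝ) a)
  have hmap : ∫ x, f (p + x) ∂(scaledMeasure μ h) = ∫ x, f (p + Real.sqrt h • x) ∂μ := by
    rw [scaledMeasure, integral_map (by fun_prop)]
    · simp
    · exact (hf.continuous.comp (continuous_const.add continuous_id)).aestronglyMeasurable
  have hfi : Integrable (fun x => f (p + Real.sqrt h • x)) μ := by
    obtain ⟨M, hM⟩ := hf.bounded
    refine .of_bound (hf.continuous.comp (by fun_prop)).aestronglyMeasurable M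
      (ae_of_all _ fun x => by simpa using hM (p + Real.sqrt h • x) 0)
  have hLi : Integrable (fun x => jetLin G p (Real.sqrt h • x)) μ :=
    integrable_finsetSum _ fun a _ => by
      simpa using ((hcoord a).const_mul _).const_mul _
  have hQ : ∀ x, jetQuad H p (Real.sqrt h • x) = ∑ a, ∑ b, h * (H a b p * (x a * x b)) := by
    intro x
    refine Finset.sum_congr rfl fun a _ => Finset.sum_congr rfl fun b _ => ?_
    simp only [Pi.smul_apply, smul_eq_mul]
    linear_combination (H a b p * (x a * x b)) * Real.mul_self_sqrt hh
  have hQi' : ∀ a b, Integrable (fun x => h * (H a b p * (x a * x b))) μ := fun a b =>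
    ((integrable_coord_mul a b).const_mul _).const_mul _
  have hQi : Integrable (fun x => jetQuad H p (Real.sqrt h • x)) μ := by
    simp_rw [hQ]
    exact integrable_finsetSum _ fun a _ => integrable_finsetSum _ fun b _ => hQi' a b
  have hL0 : ∫ x, jetLin G p (Real.sqrt h • x) ∂μ = 0 := by
    simp only [jetLin, Pi.smul_apply, smul_eq_mul]
    rw [integral_finsetSum _ fun a _ => ((hcoord a).const_mul _).const_mul _]
    simp [integral_const_mul, hμ]
  have hQ0 : ∫ x, jetQuad H p (Real.sqrt h • x) ∂μ
      = h * ∑ a, ∑ b, H a b p * ∫ x, x a * x b ∂μ := by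
    simp_rw [hQ]
    rw [integral_finsetSum _ fun a _ => integrable_finsetSum _ fun b _ => hQi' a b]
    simp_rw [integral_finsetSum _ fun b _ => hQi' _ b, integral_const_mul, Finset.mul_sum]
  have hmain : ∫ x, f (p + x) ∂(scaledMeasure μ h) - f p
      - h * ∑ a, ∑ b, H a b p * ∫ x, x a * x b ∂μ
      = ∫ x, (f (p + Real.sqrt h • x) - f p - jetLin G p (Real.sqrt h • x)
        - jetQuad H p (Real.sqrt h • x)) ∂μ := by
    have h1 : Integrable (fun x => f (p + Real.sqrt h • x) - f p) μ :=
      hfi.sub (integrable_const _)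
    have h2 : Integrable (fun x => f (p + Real.sqrt h • x) - f p
      - jetLin G p (Real.sqrt h • x)) μ := h1.sub hLi
    rw [integral_sub h2 hQi, integral_sub h1 hLi, integral_sub hfi (integrable_const _),
      hL0, hQ0, hmap]
    simp
  rw [hmain, ← Real.norm_eq_abs, mul_assoc, mul_comm (∫ x, ‖x‖ ^ 3 ∂μ), ← integral_const_mul,
    ← integral_const_mul]
  refine norm_integral_le_of_norm_le ((h3.const_mul _).const_mul _) (ae_of_all _ fun x => ?_)
  refine (hC p (Real.sqrt h • x)).trans_eq ?_
  rw [norm_smul, mul_pow, Real.norm_of_nonneg (Real.sqrt_nonneg h)]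

/-- Gaussian comparison: the expectation of `f` grows with the covariance in the directions
where the Hessian of `f` is nonnegative. -/
theorem integral_le_integral_of_covariance {f : (ι → ℝ) → ℝ} {G H} (hf : HasBoundedJet f G H)
    (μ ν : Measure (ι → ℝ)) [IsGaussian μ] [IsGaussian ν]
    (hμ : ∀ a, ∫ x, x a ∂μ = 0) (hν : ∀ a, ∫ x, x a ∂ν = 0)
    (hH : ∀ a b p, 0 ≤ H a b p * (∫ x, x a * x b ∂μ - ∫ x, x a * x b ∂ν)) :
    ∫ x, f x ∂ν ≤ ∫ x, f x ∂μ := by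
  obtain ⟨C, hC⟩ := hf.exists_abs_integral_scaledMeasure_sub_le μ hμ
  obtain ⟨C', hC'⟩ := hf.exists_abs_integral_scaledMeasure_sub_le ν hν
  have step : ∀ h, 0 ≤ h → ∀ ρ : Measure (ι → ℝ), IsProbabilityMeasure ρ →
      ∫ x, f x ∂(ρ ∗ scaledMeasure ν h)
        ≤ ∫ x, f x ∂(ρ ∗ scaledMeasure μ h) + (C + C') * Real.sqrt h ^ 3 := by
    intro h hh ρ hρ
    have hi := fun κ : Measure (ι → ℝ) => fun (_ : IsFiniteMeasure κ) => hf.integrable κ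
    rw [integral_conv (hi _ inferInstance), integral_conv (hi _ inferInstance)]
    have hint : ∀ κ : Measure (ι → ℝ), IsProbabilityMeasure κ →
        Integrable (fun p => ∫ x, f (p + x) ∂κ) ρ := fun κ _ => by
      have h := hi (ρ ∗ κ) inferInstance
      rw [Measure.conv, integrable_map_measure hf.continuous.aestronglyMeasurable
        (by fun_prop)] at h
      exact h.integral_prod_left
    calc ∫ p, ∫ x, f (p + x) ∂(scaledMeasure ν h) ∂ρ
        ≤ ∫ p, (∫ x, f (p + x) ∂(scaledMeasure μ h) + (C + C') * Real.sqrt h ^ 3) ∂ρ := by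
          refine integral_mono (hint _ inferInstance)
            ((hint _ inferInstance).add (integrable_const _)) fun p => ?_
          have hsum : h * ∑ a, ∑ b, H a b p * ∫ x, x a * x b ∂ν
              ≤ h * ∑ a, ∑ b, H a b p * ∫ x, x a * x b ∂μ := by
            refine mul_le_mul_of_nonneg_left (Finset.sum_le_sum fun a _ =>
              Finset.sum_le_sum fun b _ => ?_) hh
            linarith [hH a b p]
          linarith [(abs_le.1 (hC h hh p)).1, (abs_le.1 (hC' h hh p)).2]
      _ = _ := by
          rw [integral_add (hint _ inferInstance) (integrable_const _)]
          simp
  have iter : ∀ h, 0 ≤ h → ∀ (k : ℕ) (ρ : Measure (ι → ℝ)), IsProbabilityMeasure ρ →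
      ∫ x, f x ∂(ρ ∗ scaledMeasure ν (k * h))
        ≤ ∫ x, f x ∂(ρ ∗ scaledMeasure μ (k * h)) + k * ((C + C') * Real.sqrt h ^ 3) := by
    intro h hh k
    induction k with
    | zero => intro ρ _; simp [scaledMeasure_zero]
    | succ k ih =>
      intro ρ _
      have hk : (0 : ℝ) ≤ k * h := by positivity
      push_cast
      rw [add_one_mul, add_one_mul, scaledMeasure_add (integral_dual_eq_zero hμ) hk hh,
        scaledMeasure_add (integral_dual_eq_zero hν) hk hh]
      have h1 := ih (ρ ∗ scaledMeasure ν h) inferInstance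
      have h2 := step h hh (ρ ∗ scaledMeasure μ (k * h)) inferInstance
      rw [Measure.conv_comm (scaledMeasure ν (k * h)), ← Measure.conv_assoc,
        ← Measure.conv_assoc]
      rw [Measure.conv_assoc ρ _ (scaledMeasure μ (k * h)),
        Measure.conv_comm (scaledMeasure ν h) (scaledMeasure μ (k * h)),
        ← Measure.conv_assoc ρ (scaledMeasure μ (k * h))] at h1
      linarith
  have hbound : ∀ m : ℕ, ∫ x, f x ∂ν ≤ ∫ x, f x ∂μ
      + (C + C') * Real.sqrt (1 / ((m : ℝ) + 1)) := by
    intro m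
    have hm : ((m + 1 : ℕ) : ℝ) * (1 / ((m : ℝ) + 1)) = 1 := by
      push_cast
      field_simp
    have h := iter (1 / ((m : ℝ) + 1)) (by positivity) (m + 1) (Measure.dirac 0) inferInstance
    rw [hm, scaledMeasure_one, scaledMeasure_one, Measure.dirac_zero_conv,
      Measure.dirac_zero_conv] at h
    refine h.trans_eq ?_
    have hs : Real.sqrt (1 / ((m : ℝ) + 1)) ^ 3
        = 1 / ((m : ℝ) + 1) * Real.sqrt (1 / ((m : ℝ) + 1)) := by
      rw [pow_succ, Real.sq_sqrt (by positivity)]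
    rw [hs]
    linear_combination (C + C') * Real.sqrt (1 / ((m : ℝ) + 1)) * hm
  refine ge_of_tendsto' (x := atTop) ?_ hbound
  have h0 : Tendsto (fun m : ℕ => Real.sqrt (1 / ((m : ℝ) + 1))) atTop (𝓝 0) := by
    simpa [Function.comp_def] using (Real.continuous_sqrt.tendsto 0).comp
      (tendsto_one_div_add_atTop_nhds_zero_nat (𝕜 := ℝ))
  simpa using (h0.const_mul (C + C')).const_add (∫ x, f x ∂μ)

end Comparison

section FiniteGordon

variable {A B : Type*} [Fintype A] [Fintype B]

lemma measurableSet_forall_exists_lt (l : A → B → ℝ) :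
    MeasurableSet {x : A × B → ℝ | ∀ a, ∃ b, l a b < x (a, b)} := by
  simp only [Set.ofPred_forall, Set.ofPred_exists]
  exact .iInter fun a => .iUnion fun b => measurableSet_lt measurable_const (measurable_pi_apply _)

lemma tendsto_integral_smoothMinMax (μ : Measure (A × B → ℝ)) [IsProbabilityMeasure μ]
    (l : A → B → ℝ) (hm : ∀ m : ℕ, AEStronglyMeasurable (smoothMinMax m l) μ) :
    Tendsto (fun m : ℕ => ∫ x, smoothMinMax m l x ∂μ) atTop
      (𝓝 (μ.real {x | ∀ a, ∃ b, l a b < x (a, b)})) := by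
  rw [← integral_indicator_one (measurableSet_forall_exists_lt l)]
  refine tendsto_integral_of_dominated_convergence (fun _ => 1) hm (integrable_const _)
    (fun m => ae_of_all _ fun x => ?_) (ae_of_all _ fun x => tendsto_smoothMinMax l x)
  rw [Real.norm_of_nonneg (smoothMinMax_nonneg _ _ _)]
  exact smoothMinMax_le_one _ _ _

/-- Gordon's inequality for finite Gaussian families. -/
theorem measure_exists_forall_le_of_covariance (μ ν : Measure (A × B → ℝ)) [IsGaussian μ]
    [IsGaussian ν] (hμ : ∀ p, ∫ x, x p ∂μ = 0) (hν : ∀ p, ∫ x, x p ∂ν = 0)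
    (hrow : ∀ a b b', ∫ x, x (a, b) * x (a, b') ∂ν = ∫ x, x (a, b) * x (a, b') ∂μ)
    (hcov : ∀ p q, ∫ x, x p * x q ∂ν ≤ ∫ x, x p * x q ∂μ) (l : A → B → ℝ) :
    μ {x | ∃ a, ∀ b, x (a, b) ≤ l a b} ≤ ν {x | ∃ a, ∀ b, x (a, b) ≤ l a b} := by
  classical
  have hreal : ν.real {x | ∀ a, ∃ b, l a b < x (a, b)}
      ≤ μ.real {x | ∀ a, ∃ b, l a b < x (a, b)} := by
    have hm : ∀ (κ : Measure (A × B → ℝ)) (m : ℕ),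
        AEStronglyMeasurable (smoothMinMax m l) κ := fun κ m => by
      obtain ⟨G, H, hj, -⟩ := exists_jet_smoothMinMax m.cast_nonneg l
      exact hj.continuous.aestronglyMeasurable
    refine le_of_tendsto_of_tendsto' (tendsto_integral_smoothMinMax ν l (hm ν))
      (tendsto_integral_smoothMinMax μ l (hm μ)) fun m => ?_
    obtain ⟨G, H, hj, hH⟩ := exists_jet_smoothMinMax (Nat.cast_nonneg (α := ℝ) m) l
    refine integral_le_integral_of_covariance hj μ ν hμ hν fun p q x => ?_
    by_cases hpq : p.1 = q.1
    · obtain ⟨a, b⟩ := p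
      obtain ⟨a', b'⟩ := q
      obtain rfl : a = a' := hpq
      rw [hrow, sub_self, mul_zero]
    · exact mul_nonneg (hH p q x hpq) (sub_nonneg.2 (hcov p q))
  have hcompl : {x : A × B → ℝ | ∃ a, ∀ b, x (a, b) ≤ l a b}
      = {x | ∀ a, ∃ b, l a b < x (a, b)}ᶜ := by
    ext x
    simp
  rw [hcompl, prob_compl_eq_one_sub (measurableSet_forall_exists_lt l),
    prob_compl_eq_one_sub (measurableSet_forall_exists_lt l)]
  exact tsub_le_tsub_left (((ENNReal.toReal_le_toReal (measure_ne_top _ _)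
    (measure_ne_top _ _)).1 hreal)) _

end FiniteGordon

section LinearProcesses

variable {Ω₁ Ω₂ : Type*} [NormedAddCommGroup Ω₁] [NormedSpace ℝ Ω₁] [MeasurableSpace Ω₁]
  [NormedAddCommGroup Ω₂] [NormedSpace ℝ Ω₂] [MeasurableSpace Ω₂]

/-- The centered Gaussian families `X` under `P₁` and `Y` under `P₂` have the same covariances
within rows, and those of `Y` are smaller across rows. -/
structure GordonOrder {α β : Type*} (P₁ : Measure Ω₁) (P₂ : Measure Ω₂)
    (X : α → β → StrongDual ℝ Ω₁) (Y : α → β → StrongDual ℝ Ω₂) : Prop where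
  mean_left : ∀ a b, ∫ ω, X a b ω ∂P₁ = 0
  mean_right : ∀ a b, ∫ ω, Y a b ω ∂P₂ = 0
  row : ∀ a b b', ∫ ω, Y a b ω * Y a b' ω ∂P₂ = ∫ ω, X a b ω * X a b' ω ∂P₁
  le : ∀ a b a' b', ∫ ω, Y a b ω * Y a' b' ω ∂P₂ ≤ ∫ ω, X a b ω * X a' b' ω ∂P₁

variable {α β : Type*} {P₁ : Measure Ω₁} {P₂ : Measure Ω₂}
    {X : α → β → StrongDual ℝ Ω₁} {Y : α → β → StrongDual ℝ Ω₂}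

namespace GordonOrder

lemma comp (h : GordonOrder P₁ P₂ X Y) {α' β' : Type*} (f : α' → α) (g : β' → β) :
    GordonOrder P₁ P₂ (fun a b => X (f a) (g b)) (fun a b => Y (f a) (g b)) :=
  ⟨fun _ _ => h.mean_left _ _, fun _ _ => h.mean_right _ _, fun _ _ _ => h.row _ _ _,
    fun _ _ _ _ => h.le _ _ _ _⟩

variable [BorelSpace Ω₁] [BorelSpace Ω₂]

lemma measure_le_of_finite [IsGaussian P₁] [IsGaussian P₂] [Fintype α] [Fintype β]
    (h : GordonOrder P₁ P₂ X Y) (l : α → β → ℝ) :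
    P₁ {ω | ∃ a, ∀ b, X a b ω ≤ l a b} ≤ P₂ {ω | ∃ a, ∀ b, Y a b ω ≤ l a b} := by
  let T₁ : Ω₁ →L[ℝ] (α × β → ℝ) := ContinuousLinearMap.pi fun p => X p.1 p.2
  let T₂ : Ω₂ →L[ℝ] (α × β → ℝ) := ContinuousLinearMap.pi fun p => Y p.1 p.2
  have hS : MeasurableSet {x : α × β → ℝ | ∃ a, ∀ b, x (a, b) ≤ l a b} := by
    simp only [Set.ofPred_forall, Set.ofPred_exists]
    exact .iUnion fun a => .iInter fun b =>
      measurableSet_le (measurable_pi_apply _) measurable_const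
  have h1 : ∀ p, ∫ x, x p ∂(P₁.map T₁) = ∫ ω, X p.1 p.2 ω ∂P₁ := fun p =>
    integral_map (by fun_prop) (measurable_pi_apply _).aestronglyMeasurable
  have h2 : ∀ p, ∫ x, x p ∂(P₂.map T₂) = ∫ ω, Y p.1 p.2 ω ∂P₂ := fun p =>
    integral_map (by fun_prop) (measurable_pi_apply _).aestronglyMeasurable
  have h1' : ∀ p q, ∫ x, x p * x q ∂(P₁.map T₁) = ∫ ω, X p.1 p.2 ω * X q.1 q.2 ω ∂P₁ :=
    fun p q => integral_map (by fun_prop) (by fun_prop)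
  have h2' : ∀ p q, ∫ x, x p * x q ∂(P₂.map T₂) = ∫ ω, Y p.1 p.2 ω * Y q.1 q.2 ω ∂P₂ :=
    fun p q => integral_map (by fun_prop) (by fun_prop)
  have := measure_exists_forall_le_of_covariance (P₁.map T₁) (P₂.map T₂)
    (fun p => (h1 p).trans (h.mean_left _ _)) (fun p => (h2 p).trans (h.mean_right _ _))
    (fun a b b' => by rw [h1', h2']; exact h.row _ _ _)
    (fun p q => by rw [h1', h2']; exact h.le _ _ _ _) l
  rwa [Measure.map_apply (by fun_prop) hS, Measure.map_apply (by fun_prop) hS] at this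

end GordonOrder

end LinearProcesses

namespace GordonOrder

variable {Ω₁ Ω₂ : Type*} [NormedAddCommGroup Ω₁] [NormedSpace ℝ Ω₁] [MeasurableSpace Ω₁]
  [NormedAddCommGroup Ω₂] [NormedSpace ℝ Ω₂] [MeasurableSpace Ω₂] [BorelSpace Ω₁] [BorelSpace Ω₂]
  {α β : Type*} {P₁ : Measure Ω₁} {P₂ : Measure Ω₂} [IsGaussian P₁] [IsGaussian P₂]
  {X : α → β → StrongDual ℝ Ω₁} {Y : α → β → StrongDual ℝ Ω₂}
  [TopologicalSpace α] [SecondCountableTopology α] [TopologicalSpace β] [SecondCountableTopology β]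

lemma measure_le_of_compact [CompactSpace α] [Nonempty β] (h : GordonOrder P₁ P₂ X Y)
    (c : α → β → ℝ) (t : ℝ) (hX : ∀ b ω, Continuous fun a => X a b ω + c a b)
    (hY : ∀ b, Continuous fun p : α × Ω₂ => Y p.1 b p.2 + c p.1 b)
    (hY' : ∀ a ω, Continuous fun b => Y a b ω + c a b) :
    P₁ {ω | ∃ a, ∀ b, X a b ω + c a b ≤ t} ≤ P₂ {ω | ∃ a, ∀ b, Y a b ω + c a b ≤ t} := by
  cases isEmpty_or_nonempty α
  · simp
  let u : ℕ → α := TopologicalSpace.denseSeq α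
  let v : ℕ → β := TopologicalSpace.denseSeq β
  let S : ℕ → Set (α × Ω₂) := fun k =>
    {p | ∀ j ≤ k, Y p.1 (v j) p.2 + c p.1 (v j) ≤ t + 1 / ((k : ℝ) + 1)}
  let B : ℕ → Set Ω₂ := fun k => Prod.snd '' S k
  have hSc : ∀ k, IsClosed (S k) := fun k => by
    simp only [S, Set.ofPred_forall]
    exact isClosed_iInter fun j => isClosed_iInter fun _ => isClosed_le (hY _) continuous_const
  have hSa : Antitone S := fun k k' hk p hp j hj => by
    refine (hp j (hj.trans hk)).trans ?_
    gcongr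
  have hBc : ∀ k, IsClosed (B k) := fun k => isClosedMap_snd_of_compactSpace _ (hSc k)
  have hBa : Antitone B := fun k k' hk => Set.image_mono (hSa hk)
  have hB : ⋂ k, B k ⊆ {ω | ∃ a, ∀ b, Y a b ω + c a b ≤ t} := by
    intro ω hω
    rw [Set.mem_iInter] at hω
    let F : ℕ → Set α := fun k => (fun a => (a, ω)) ⁻¹' S k
    have hF : (⋂ k, F k).Nonempty := by
      refine IsCompact.nonempty_iInter_of_sequence_nonempty_isCompact_isClosed F
        (fun k => Set.preimage_mono (hSa k.le_succ)) (fun k => ?_)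
        ((hSc 0).preimage (by fun_prop)).isCompact fun k => (hSc k).preimage (by fun_prop)
      obtain ⟨⟨a, ω'⟩, hp, rfl⟩ := hω k
      exact ⟨a, hp⟩
    obtain ⟨a, ha⟩ := hF
    rw [Set.mem_iInter] at ha
    have hv : ∀ j, Y a (v j) ω + c a (v j) ≤ t := fun j => by
      refine ge_of_tendsto (x := atTop) (f := fun k : ℕ => t + 1 / ((k : ℝ) + 1)) ?_
        (eventually_atTop.2 ⟨j, fun k hk => ha k j hk⟩)
      simpa using tendsto_one_div_add_atTop_nhds_zero_nat.const_add t
    refine ⟨a, fun b => ?_⟩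
    exact (TopologicalSpace.denseRange_denseSeq β).induction_on (p := fun b => Y a b ω + c a b ≤ t)
      b (isClosed_le (hY' a ω) continuous_const) hv
  have hk : ∀ k, P₁ {ω | ∃ a, ∀ b, X a b ω + c a b ≤ t} ≤ P₂ (B k) := by
    intro k
    let A : ℕ → Set Ω₁ := fun m => {ω | ∃ i ≤ m, ∀ j ≤ k,
      X (u i) (v j) ω + c (u i) (v j) ≤ t + 1 / ((k : ℝ) + 1)}
    have hA : Monotone A := by
      rintro m m' hm ω ⟨i, hi, hω⟩
      exact ⟨i, hi.trans hm, hω⟩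
    have hsub : {ω | ∃ a, ∀ b, X a b ω + c a b ≤ t} ⊆ ⋃ m, A m := by
      rintro ω ⟨a, ha⟩
      have hopen : IsOpen {a | ∀ j ≤ k, X a (v j) ω + c a (v j) < t + 1 / ((k : ℝ) + 1)} := by
        simp only [Set.ofPred_forall]
        exact (Set.finite_Iic k).isOpen_biInter fun j _ => isOpen_lt (hX _ _) continuous_const
      obtain ⟨i, hi⟩ := (TopologicalSpace.denseRange_denseSeq α).exists_mem_open hopen
        ⟨a, fun j _ => (ha _).trans_lt (lt_add_of_pos_right _ (by positivity))⟩
      exact Set.mem_iUnion.2 ⟨i, i, le_rfl, fun j hj => (hi j hj).le⟩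
    refine (measure_mono hsub).trans ?_
    rw [hA.measure_iUnion]
    refine iSup_le fun m => ?_
    have hfin := (h.comp (fun i : Fin (m + 1) => u i)
      (fun j : Fin (k + 1) => v j)).measure_le_of_finite
      fun i j => t + 1 / ((k : ℝ) + 1) - c (u i) (v j)
    refine le_trans (measure_mono ?_) (hfin.trans (measure_mono ?_))
    · rintro ω ⟨i, hi, hω⟩
      exact ⟨⟨i, Nat.lt_succ_of_le hi⟩, fun j =>
        le_sub_iff_add_le.2 (hω j (Nat.le_of_lt_succ j.2))⟩
    · rintro ω ⟨i, hω⟩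
      exact ⟨(u i, ω), fun j hj => le_sub_iff_add_le.1 (hω ⟨j, Nat.lt_succ_of_le hj⟩), rfl⟩
  refine le_trans ?_ (measure_mono hB)
  rw [hBa.measure_iInter (fun k => (hBc k).measurableSet.nullMeasurableSet)
    ⟨0, measure_ne_top _ _⟩]
  exact le_iInf hk

/-- Gordon's inequality for the min-max of continuous Gaussian families. -/
theorem measure_le [SigmaCompactSpace α] [Nonempty β] (h : GordonOrder P₁ P₂ X Y)
    (c : α → β → ℝ) (t : ℝ) (hX : ∀ b ω, Continuous fun a => X a b ω + c a b)
    (hY : ∀ b, Continuous fun p : α × Ω₂ => Y p.1 b p.2 + c p.1 b)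
    (hY' : ∀ a ω, Continuous fun b => Y a b ω + c a b) :
    P₁ {ω | ∃ a, ∀ b, X a b ω + c a b ≤ t} ≤ P₂ {ω | ∃ a, ∀ b, Y a b ω + c a b ≤ t} := by
  let K := compactCovering α
  let A : ℕ → Set Ω₁ := fun m => {ω | ∃ a : K m, ∀ b, X a b ω + c a b ≤ t}
  have hA : Monotone A := fun m m' hm ω ⟨a, hω⟩ => ⟨⟨a, compactCovering_subset α hm a.2⟩, hω⟩
  have hsub : {ω | ∃ a, ∀ b, X a b ω + c a b ≤ t} ⊆ ⋃ m, A m := by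
    rintro ω ⟨a, ha⟩
    obtain ⟨m, hm⟩ := exists_mem_compactCovering a
    exact Set.mem_iUnion.2 ⟨m, ⟨a, hm⟩, ha⟩
  refine (measure_mono hsub).trans ?_
  rw [hA.measure_iUnion]
  refine iSup_le fun m => ?_
  have : CompactSpace (K m) := isCompact_iff_compactSpace.1 (isCompact_compactCovering α m)
  refine ((h.comp (fun a : K m => (a : α)) id).measure_le_of_compact (fun a b => c a b) t
    (fun b ω => (hX b ω).comp continuous_subtype_val)
    (fun b => (hY b).comp (continuous_subtype_val.prodMap continuous_id))
    fun a ω => hY' a ω).trans (measure_mono ?_)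
  rintro ω ⟨a, ha⟩
  exact ⟨a, ha⟩

end GordonOrder

section GaussianProducts

lemma isGaussian_pi {ι : Type*} [Fintype ι] {E : ι → Type*} [∀ i, NormedAddCommGroup (E i)]
    [∀ i, NormedSpace ℝ (E i)] [∀ i, MeasurableSpace (E i)] [∀ i, BorelSpace (E i)]
    [∀ i, SecondCountableTopology (E i)] [∀ i, CompleteSpace (E i)]
    (μ : ∀ i, Measure (E i)) [∀ i, IsGaussian (μ i)] : IsGaussian (Measure.pi μ) := by
  have h := (iIndepFun_pi (μ := μ) (X := fun _ x => x) fun _ => aemeasurable_id').hasGaussianLaw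
    fun i => ⟨by
      rw [(measurePreserving_eval μ i).map_eq]
      infer_instance⟩
  simpa using h.isGaussian_map

lemma gaussianReal_Ici_zero : gaussianReal 0 1 (Set.Ici 0) = gaussianReal 0 1 (Set.Iic 0) := by
  have h := gaussianReal_map_neg (μ := 0) (v := 1)
  rw [neg_zero] at h
  conv_lhs => rw [← h]
  rw [Measure.map_apply measurable_neg measurableSet_Ici]
  simp

lemma one_le_two_mul_gaussianReal_Iic : 1 ≤ 2 * gaussianReal 0 1 (Set.Iic 0) :=
  calc (1 : ℝ≥0∞) = gaussianReal 0 1 (Set.Iic 0 ∪ Set.Ici 0) := by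
        rw [Set.Iic_union_Ici, measure_univ]
    _ ≤ gaussianReal 0 1 (Set.Iic 0) + gaussianReal 0 1 (Set.Ici 0) := measure_union_le _ _
    _ = _ := by rw [gaussianReal_Ici_zero, two_mul]

lemma measure_le_two_mul_prod {Ω : Type*} [MeasurableSpace Ω] {P : Measure Ω} {Q : Measure ℝ}
    [SFinite P] [SFinite Q] {T : Set ℝ} (hT : 1 ≤ 2 * Q T) {A : Set Ω} {B : Set (Ω × ℝ)}
    (h : A ×ˢ T ⊆ B) : P A ≤ 2 * P.prod Q B :=
  calc P A = P A * 1 := (mul_one _).symm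
    _ ≤ P A * (2 * Q T) := by gcongr
    _ = 2 * P.prod Q (A ×ˢ T) := by rw [Measure.prod_prod]; ring
    _ ≤ 2 * P.prod Q B := by gcongr

/-- `f` and `g` are centered, square integrable, with covariance `c`. -/
structure HasCenteredCov {Ω : Type*} [MeasurableSpace Ω] (P : Measure Ω) (f g : Ω → ℝ) (c : ℝ) :
    Prop where
  memLp_left : MemLp f 2 P
  memLp_right : MemLp g 2 P
  mean_left : ∫ ω, f ω ∂P = 0
  mean_right : ∫ ω, g ω ∂P = 0
  integral_mul : ∫ ω, f ω * g ω ∂P = c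

namespace HasCenteredCov

lemma gaussianReal (v : ℝ≥0) (a b : ℝ) :
    HasCenteredCov (gaussianReal 0 v) (fun x => a * x) (fun x => b * x) (a * b * v) := by
  have h : ∀ a : ℝ, MemLp (fun x => a * x) 2 (ProbabilityTheory.gaussianReal 0 v) := fun a =>
    (memLp_id_gaussianReal' 2 (by simp)).const_mul a
  have h0 : ∀ a : ℝ, ∫ x, a * x ∂(ProbabilityTheory.gaussianReal 0 v) = 0 := fun a => by
    rw [integral_const_mul, integral_id_gaussianReal, mul_zero]
  refine ⟨h a, h b, h0 a, h0 b, ?_⟩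
  have hv := variance_fun_id_gaussianReal (μ := 0) (v := v)
  rw [variance_of_integral_eq_zero aemeasurable_id' integral_id_gaussianReal] at hv
  rw [← hv, ← integral_const_mul]
  exact integral_congr_ae (ae_of_all _ fun x => by ring)

lemma prod {Ω Ω' : Type*} [MeasurableSpace Ω] [MeasurableSpace Ω'] {P : Measure Ω} {Q : Measure Ω'}
    [IsProbabilityMeasure P] [IsProbabilityMeasure Q] {f g : Ω → ℝ} {f' g' : Ω' → ℝ} {c c' : ℝ}
    (h : HasCenteredCov P f g c) (h' : HasCenteredCov Q f' g' c') :
    HasCenteredCov (P.prod Q) (fun p => f p.1 + f' p.2) (fun p => g p.1 + g' p.2) (c + c') := by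
  have e1 : MeasurePreserving Prod.fst (P.prod Q) P := measurePreserving_fst
  have e2 : MeasurePreserving Prod.snd (P.prod Q) Q := measurePreserving_snd
  have hf := h.memLp_left.comp_measurePreserving e1
  have hg := h.memLp_right.comp_measurePreserving e1
  have hf' := h'.memLp_left.comp_measurePreserving e2
  have hg' := h'.memLp_right.comp_measurePreserving e2
  have i1 : Integrable (fun p : Ω × Ω' => f p.1) (P.prod Q) := hf.integrable (by norm_num)
  have i2 : Integrable (fun p : Ω × Ω' => g p.1) (P.prod Q) := hg.integrable (by norm_num)
  have i3 : Integrable (fun p : Ω × Ω' => f' p.2) (P.prod Q) := hf'.integrable (by norm_num)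
  have i4 : Integrable (fun p : Ω × Ω' => g' p.2) (P.prod Q) := hg'.integrable (by norm_num)
  refine ⟨hf.add hf', hg.add hg', ?_, ?_, ?_⟩
  · rw [integral_add i1 i3, integral_fun_fst, integral_fun_snd]
    simp [h.mean_left, h'.mean_left]
  · rw [integral_add i2 i4, integral_fun_fst, integral_fun_snd]
    simp [h.mean_right, h'.mean_right]
  · have j1 : Integrable (fun p : Ω × Ω' => f p.1 * g p.1) (P.prod Q) := hf.integrable_mul hg
    have j2 : Integrable (fun p : Ω × Ω' => f p.1 * g' p.2) (P.prod Q) := hf.integrable_mul hg'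
    have j3 : Integrable (fun p : Ω × Ω' => f' p.2 * g p.1) (P.prod Q) := hf'.integrable_mul hg
    have j4 : Integrable (fun p : Ω × Ω' => f' p.2 * g' p.2) (P.prod Q) := hf'.integrable_mul hg'
    have k2 : ∫ p : Ω × Ω', f p.1 * g' p.2 ∂(P.prod Q) = 0 := by
      rw [integral_prod_mul, h.mean_left, zero_mul]
    have k3 : ∫ p : Ω × Ω', f' p.2 * g p.1 ∂(P.prod Q) = 0 := by
      simp_rw [mul_comm (f' _)]
      rw [integral_prod_mul, h.mean_right, zero_mul]
    have l1 : Integrable (fun p : Ω × Ω' => f p.1 * g p.1 + f p.1 * g' p.2) (P.prod Q) := j1.add j2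
    have l2 : Integrable (fun p : Ω × Ω' => f' p.2 * g p.1 + f' p.2 * g' p.2) (P.prod Q) :=
      j3.add j4
    simp_rw [add_mul, mul_add]
    rw [integral_add l1 l2, integral_add j1 j2, integral_add j3 j4, k2, k3,
      integral_fun_fst (f := fun x => f x * g x), integral_fun_snd (f := fun x => f' x * g' x),
      h.integral_mul, h'.integral_mul]
    simp

lemma pi {ι : Type*} [Fintype ι] {E : ι → Type*} [∀ i, MeasurableSpace (E i)]
    {μ : ∀ i, Measure (E i)} [∀ i, IsProbabilityMeasure (μ i)] {f g : ∀ i, E i → ℝ} {c : ι → ℝ}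
    (h : ∀ i, HasCenteredCov (μ i) (f i) (g i) (c i)) :
    HasCenteredCov (Measure.pi μ) (fun x => ∑ i, f i (x i)) (fun x => ∑ i, g i (x i))
      (∑ i, c i) := by
  classical
  have e := fun i => measurePreserving_eval μ i
  have hf : ∀ i, MemLp (fun x : ∀ i, E i => f i (x i)) 2 (Measure.pi μ) := fun i =>
    (h i).memLp_left.comp_measurePreserving (e i)
  have hg : ∀ i, MemLp (fun x : ∀ i, E i => g i (x i)) 2 (Measure.pi μ) := fun i =>
    (h i).memLp_right.comp_measurePreserving (e i)
  have hmap : ∀ i (k : E i → ℝ), AEStronglyMeasurable k (μ i) →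
      ∫ x : ∀ i, E i, k (x i) ∂(Measure.pi μ) = ∫ y, k y ∂(μ i) := fun i k hk => by
    rw [← (e i).map_eq] at hk ⊢
    exact (integral_map (measurable_pi_apply i).aemeasurable hk).symm
  refine ⟨memLp_finsetSum _ fun i _ => hf i, memLp_finsetSum _ fun i _ => hg i, ?_, ?_, ?_⟩
  · rw [integral_finsetSum _ fun i _ => (hf i).integrable (by norm_num)]
    exact Finset.sum_eq_zero fun i _ =>
      (hmap i _ (h i).memLp_left.aestronglyMeasurable).trans (h i).mean_left
  · rw [integral_finsetSum _ fun i _ => (hg i).integrable (by norm_num)]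
    exact Finset.sum_eq_zero fun i _ =>
      (hmap i _ (h i).memLp_right.aestronglyMeasurable).trans (h i).mean_right
  · have hint : ∀ i j, Integrable (fun x : ∀ i, E i => f i (x i) * g j (x j)) (Measure.pi μ) :=
      fun i j => (hf i).integrable_mul (hg j)
    simp_rw [Finset.sum_mul_sum]
    rw [integral_finsetSum _ fun i _ => integrable_finsetSum _ fun j _ => hint i j]
    refine Finset.sum_congr rfl fun i _ => ?_
    rw [integral_finsetSum _ fun j _ => hint i j, Finset.sum_eq_single i]
    · refine (hmap i (fun y => f i y * g i y) ?_).trans (h i).integral_mul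
      exact (h i).memLp_left.aestronglyMeasurable.mul (h i).memLp_right.aestronglyMeasurable
    · intro j _ hji
      have hind : IndepFun (fun x : ∀ i, E i => x i) (fun x : ∀ i, E i => x j) (Measure.pi μ) :=
        (iIndepFun_pi (μ := μ) (X := fun _ x => x) fun _ => aemeasurable_id').indepFun hji.symm
      have hind' : IndepFun (fun x : ∀ i, E i => f i (x i)) (fun x : ∀ i, E i => g j (x j))
          (Measure.pi μ) := by
        refine hind.comp₀ (φ := f i) (ψ := g j) (e i).aemeasurable (e j).aemeasurable ?_ ?_
        · rw [(e i).map_eq]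
          exact (h i).memLp_left.aestronglyMeasurable.aemeasurable
        · rw [(e j).map_eq]
          exact (h j).memLp_right.aestronglyMeasurable.aemeasurable
      rw [hind'.integral_fun_mul_eq_mul_integral (hf i).aestronglyMeasurable
        (hg j).aestronglyMeasurable, hmap i _ (h i).memLp_left.aestronglyMeasurable,
        (h i).mean_left, zero_mul]
    · simp

end HasCenteredCov

end GaussianProducts

section Lasso

variable {n N : ℕ}

instance : IsGaussian (PX n N) :=
  have : IsGaussian (Measure.pi fun _ : Fin N => gaussianReal 0 ((n : ℝ≥0))⁻¹) := isGaussian_pi _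
  isGaussian_pi _

instance : IsGaussian (Pz n) := isGaussian_pi _

instance : IsGaussian (Pmodel n N) := inferInstanceAs (IsGaussian ((PX n N).prod (Pz n)))

instance : IsGaussian (Pgordon n N) :=
  have : IsGaussian (Measure.pi fun _ : Fin N => gaussianReal 0 1) := isGaussian_pi _
  have : IsGaussian (Measure.pi fun _ : Fin n => gaussianReal 0 1) := isGaussian_pi _
  inferInstanceAs (IsGaussian (Measure.prod _ (Measure.prod _ _)))

/-- A linear form in `((X, z), ζ)`. -/
def primaryForm (A : Fin n → Fin N → ℝ) (b : Fin n → ℝ) (c : ℝ) :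
    StrongDual ℝ (((Fin n → Fin N → ℝ) × (Fin n → ℝ)) × ℝ) :=
  LinearMap.toContinuousLinearMap
    { toFun := fun ω => ∑ i, ∑ j, A i j * ω.1.1 i j + ∑ i, b i * ω.1.2 i + c * ω.2
      map_add' := fun ω ω' => by
        simp only [Prod.fst_add, Prod.snd_add, Pi.add_apply, mul_add, Finset.sum_add_distrib]
        ring
      map_smul' := fun k ω => by
        simp only [Prod.smul_fst, Prod.smul_snd, Pi.smul_apply, smul_eq_mul, RingHom.id_apply,
          mul_add, Finset.mul_sum, mul_left_comm k] }

lemma primaryForm_apply (A : Fin n → Fin N → ℝ) (b : Fin n → ℝ) (c : ℝ) (ω) :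
    primaryForm A b c ω = ∑ i, ∑ j, A i j * ω.1.1 i j + ∑ i, b i * ω.1.2 i + c * ω.2 := rfl

/-- A linear form in `(g, (h, g'))`. -/
def auxiliaryForm (a : Fin N → ℝ) (b : Fin n → ℝ) (c : ℝ) :
    StrongDual ℝ ((Fin N → ℝ) × ((Fin n → ℝ) × ℝ)) :=
  LinearMap.toContinuousLinearMap
    { toFun := fun ω => ∑ j, a j * ω.1 j + (∑ i, b i * ω.2.1 i + c * ω.2.2)
      map_add' := fun ω ω' => by
        simp only [Prod.fst_add, Prod.snd_add, Pi.add_apply, mul_add, Finset.sum_add_distrib]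
        ring
      map_smul' := fun k ω => by
        simp only [Prod.smul_fst, Prod.smul_snd, Pi.smul_apply, smul_eq_mul, RingHom.id_apply,
          mul_add, Finset.mul_sum, mul_left_comm k] }

lemma auxiliaryForm_apply (a : Fin N → ℝ) (b : Fin n → ℝ) (c : ℝ) (ω) :
    auxiliaryForm a b c ω = ∑ j, a j * ω.1 j + (∑ i, b i * ω.2.1 i + c * ω.2.2) := rfl

lemma hasCenteredCov_primaryForm (A A' : Fin n → Fin N → ℝ) (b b' : Fin n → ℝ) (c c' : ℝ) :
    HasCenteredCov ((Pmodel n N).prod (gaussianReal 0 1)) (primaryForm A b c)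
      (primaryForm A' b' c')
      (∑ i, ∑ j, A i j * A' i j * (n : ℝ)⁻¹ + ∑ i, b i * b' i + c * c') := by
  have h1 := HasCenteredCov.pi fun i : Fin n => HasCenteredCov.pi fun j : Fin N =>
    HasCenteredCov.gaussianReal ((n : ℝ≥0))⁻¹ (A i j) (A' i j)
  have h2 := HasCenteredCov.pi fun i : Fin n => HasCenteredCov.gaussianReal 1 (b i) (b' i)
  have h := (h1.prod h2).prod (HasCenteredCov.gaussianReal 1 c c')
  simp only [NNReal.coe_inv, NNReal.coe_natCast, NNReal.coe_one, mul_one] at h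
  exact h

lemma hasCenteredCov_auxiliaryForm (a a' : Fin N → ℝ) (b b' : Fin n → ℝ) (c c' : ℝ) :
    HasCenteredCov (Pgordon n N) (auxiliaryForm a b c) (auxiliaryForm a' b' c')
      (∑ j, a j * a' j + (∑ i, b i * b' i + c * c')) := by
  have h1 := HasCenteredCov.pi fun j : Fin N => HasCenteredCov.gaussianReal 1 (a j) (a' j)
  have h2 := HasCenteredCov.pi fun i : Fin n => HasCenteredCov.gaussianReal 1 (b i) (b' i)
  have h := h1.prod (h2.prod (HasCenteredCov.gaussianReal 1 c c'))
  simp only [NNReal.coe_one, mul_one] at h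
  exact h

/-- The Euclidean norm of `u`. -/
def l2norm {ι : Type*} [Fintype ι] (u : ι → ℝ) : ℝ := Real.sqrt (∑ i, u i ^ 2)

/-- The norm of `(w / √n, σ)`. -/
def liftedNorm (n : ℕ) (σ : ℝ) (w : Fin N → ℝ) : ℝ := Real.sqrt ((∑ j, w j ^ 2) / n + σ ^ 2)

/-- The primary Gaussian process. -/
def primaryField (n : ℕ) (σ : ℝ) (w : Fin N → ℝ) (u : Fin n → ℝ) :
    StrongDual ℝ (((Fin n → Fin N → ℝ) × (Fin n → ℝ)) × ℝ) :=
  primaryForm (fun i j => u i * w j / Real.sqrt n) (fun i => -(σ * u i / Real.sqrt n))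
    (l2norm u * liftedNorm n σ w / Real.sqrt n)

/-- The auxiliary Gaussian process. -/
def auxiliaryField (n : ℕ) (σ : ℝ) (w : Fin N → ℝ) (u : Fin n → ℝ) :
    StrongDual ℝ ((Fin N → ℝ) × ((Fin n → ℝ) × ℝ)) :=
  auxiliaryForm (fun j => -(l2norm u * w j / n)) (fun i => liftedNorm n σ w * u i / Real.sqrt n)
    (l2norm u * σ / Real.sqrt n)

lemma sum_mul_le_l2norm {ι : Type*} [Fintype ι] (u u' : ι → ℝ) :
    ∑ i, u i * u' i ≤ l2norm u * l2norm u' :=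
  Real.sum_mul_le_sqrt_mul_sqrt _ _ _

lemma l2norm_mul_self {ι : Type*} [Fintype ι] (u : ι → ℝ) :
    l2norm u * l2norm u = ∑ i, u i * u i := by
  rw [l2norm, Real.mul_self_sqrt (by positivity)]
  simp [sq]

lemma liftedNorm_mul_self (σ : ℝ) (w : Fin N → ℝ) :
    liftedNorm n σ w * liftedNorm n σ w = (∑ j, w j * w j) / n + σ ^ 2 := by
  rw [liftedNorm, Real.mul_self_sqrt (by positivity)]
  simp [sq]

lemma le_liftedNorm_mul (σ : ℝ) (w w' : Fin N → ℝ) :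
    (∑ j, w j * w' j) / n + σ ^ 2 ≤ liftedNorm n σ w * liftedNorm n σ w' := by
  have key : ∀ w : Fin N → ℝ, liftedNorm n σ w
      = l2norm (Option.elim · σ fun j => w j / Real.sqrt n : Option (Fin N) → ℝ) := fun w => by
    simp [liftedNorm, l2norm, Fintype.sum_option, div_pow, Finset.sum_div, add_comm]
  rw [key, key]
  refine le_trans (le_of_eq ?_) (sum_mul_le_l2norm _ _)
  simp [Fintype.sum_option, Finset.sum_div, add_comm, div_mul_div_comm, sq]

lemma integral_primaryField (σ : ℝ) (w : Fin N → ℝ) (u : Fin n → ℝ) :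
    ∫ ω, primaryField n σ w u ω ∂((Pmodel n N).prod (gaussianReal 0 1)) = 0 :=
  (hasCenteredCov_primaryForm _ 0 _ 0 _ 0).mean_left

lemma integral_auxiliaryField (σ : ℝ) (w : Fin N → ℝ) (u : Fin n → ℝ) :
    ∫ ω, auxiliaryField n σ w u ω ∂(Pgordon n N) = 0 :=
  (hasCenteredCov_auxiliaryForm _ 0 _ 0 _ 0).mean_left

lemma integral_primaryField_mul (σ : ℝ) (w w' : Fin N → ℝ) (u u' : Fin n → ℝ) :
    ∫ ω, primaryField n σ w u ω * primaryField n σ w' u' ω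
        ∂((Pmodel n N).prod (gaussianReal 0 1))
      = ((∑ i, u i * u' i) * ((∑ j, w j * w' j) / n + σ ^ 2)
        + l2norm u * l2norm u' * (liftedNorm n σ w * liftedNorm n σ w')) / n := by
  refine (hasCenteredCov_primaryForm _ _ _ _ _ _).integral_mul.trans ?_
  have hs : Real.sqrt n * Real.sqrt n = n := Real.mul_self_sqrt n.cast_nonneg
  have h1 : ∑ i, ∑ j, u i * w j / Real.sqrt n * (u' i * w' j / Real.sqrt n) * (n : ℝ)⁻¹
      = (∑ i, u i * u' i) * ((∑ j, w j * w' j) / n) / n := by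
    rw [Finset.sum_div, Finset.sum_mul_sum, Finset.sum_div]
    refine Finset.sum_congr rfl fun i _ => ?_
    rw [Finset.sum_div]
    refine Finset.sum_congr rfl fun j _ => ?_
    rw [div_mul_div_comm, hs]
    ring
  have h2 : ∑ i, -(σ * u i / Real.sqrt n) * -(σ * u' i / Real.sqrt n)
      = (∑ i, u i * u' i) * σ ^ 2 / n := by
    rw [Finset.sum_mul, Finset.sum_div]
    refine Finset.sum_congr rfl fun i _ => ?_
    rw [neg_mul_neg, div_mul_div_comm, hs]
    ring
  rw [h1, h2, div_mul_div_comm, hs]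
  ring

lemma integral_auxiliaryField_mul (σ : ℝ) (w w' : Fin N → ℝ) (u u' : Fin n → ℝ) :
    ∫ ω, auxiliaryField n σ w u ω * auxiliaryField n σ w' u' ω ∂(Pgordon n N)
      = (l2norm u * l2norm u' * ((∑ j, w j * w' j) / n + σ ^ 2)
        + (∑ i, u i * u' i) * (liftedNorm n σ w * liftedNorm n σ w')) / n := by
  refine (hasCenteredCov_auxiliaryForm _ _ _ _ _ _).integral_mul.trans ?_
  have hs : Real.sqrt n * Real.sqrt n = n := Real.mul_self_sqrt n.cast_nonneg
  have h1 : ∑ j, -(l2norm u * w j / n) * -(l2norm u' * w' j / n)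
      = l2norm u * l2norm u' * ((∑ j, w j * w' j) / n) / n := by
    rw [Finset.sum_div, Finset.mul_sum, Finset.sum_div]
    refine Finset.sum_congr rfl fun j _ => ?_
    ring
  have h2 : ∑ i, liftedNorm n σ w * u i / Real.sqrt n * (liftedNorm n σ w' * u' i / Real.sqrt n)
      = (∑ i, u i * u' i) * (liftedNorm n σ w * liftedNorm n σ w') / n := by
    rw [Finset.sum_mul, Finset.sum_div]
    refine Finset.sum_congr rfl fun i _ => ?_
    rw [div_mul_div_comm, hs]
    ring
  rw [h1, h2, div_mul_div_comm, hs]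
  ring

lemma integral_process_mul_le (σ : ℝ) (w w' : Fin N → ℝ) (u u' : Fin n → ℝ) :
    ∫ ω, auxiliaryField n σ w u ω * auxiliaryField n σ w' u' ω ∂(Pgordon n N)
      ≤ ∫ ω, primaryField n σ w u ω * primaryField n σ w' u' ω
        ∂((Pmodel n N).prod (gaussianReal 0 1)) := by
  rw [integral_primaryField_mul, integral_auxiliaryField_mul]
  gcongr ?_ / _
  nlinarith [mul_nonneg (sub_nonneg.2 (sum_mul_le_l2norm u u'))
    (sub_nonneg.2 (le_liftedNorm_mul (n := n) σ w w'))]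

lemma gordonOrder_process (n : ℕ) (σ : ℝ) (D : Set (Fin N → ℝ)) :
    GordonOrder ((Pmodel n N).prod (gaussianReal 0 1)) (Pgordon n N)
      (fun (w : D) u => primaryField n σ w u) (fun (w : D) u => auxiliaryField n σ w u) where
  mean_left _ _ := integral_primaryField _ _ _
  mean_right _ _ := integral_auxiliaryField _ _ _
  row _ _ _ := by
    rw [integral_primaryField_mul, integral_auxiliaryField_mul, ← liftedNorm_mul_self]
    ring
  le _ _ _ _ := integral_process_mul_le _ _ _ _ _

lemma gordonOrder_neg_process (n : ℕ) (σ : ℝ) (D : Set (Fin N → ℝ)) :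
    GordonOrder ((Pmodel n N).prod (gaussianReal 0 1)) (Pgordon n N)
      (fun u (w : D) => -primaryField n σ w u) (fun u (w : D) => -auxiliaryField n σ w u) where
  mean_left _ _ := by simp [integral_neg, integral_primaryField]
  mean_right _ _ := by simp [integral_neg, integral_auxiliaryField]
  row _ _ _ := by
    simp only [_root_.neg_apply, neg_mul_neg]
    rw [integral_primaryField_mul, integral_auxiliaryField_mul, ← l2norm_mul_self]
  le _ _ _ _ := by
    simp only [_root_.neg_apply, neg_mul_neg]
    exact integral_process_mul_le _ _ _ _ _

end Lasso

section LassoDeterministic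

variable {n N : ℕ} {σ lam : ℝ} {θ : Fin N → ℝ}

/-- The penalty `(λ / n) (‖w + θ‖₁ - ‖θ‖₁)`. -/
def lassoPenalty (n : ℕ) (lam : ℝ) (θ w : Fin N → ℝ) : ℝ :=
  (lam / (n : ℝ)) * (∑ j, |w j + θ j| - ∑ j, |θ j|)

/-- The normalized residual `(X w - σ z) / √n`. -/
def lassoResidual (σ : ℝ) (X : Fin n → Fin N → ℝ) (z : Fin n → ℝ) (w : Fin N → ℝ) (i : Fin n) : ℝ :=
  (∑ j, X i j * w j - σ * z i) / Real.sqrt n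

/-- The non-random part of the min-max objectives. -/
def minMaxOffset (lam : ℝ) (θ w : Fin N → ℝ) (u : Fin n → ℝ) : ℝ :=
  lassoPenalty n lam θ w - (∑ i, u i ^ 2) / 2

lemma l2norm_nonneg {ι : Type*} [Fintype ι] (u : ι → ℝ) : 0 ≤ l2norm u := Real.sqrt_nonneg _

lemma l2norm_sq {ι : Type*} [Fintype ι] (u : ι → ℝ) : l2norm u ^ 2 = ∑ i, u i ^ 2 :=
  Real.sq_sqrt (by positivity)

lemma l2norm_smul {ι : Type*} [Fintype ι] {c : ℝ} (hc : 0 ≤ c) (u : ι → ℝ) :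
    l2norm (c • u) = c * l2norm u := by
  simp only [l2norm, Pi.smul_apply, smul_eq_mul, mul_pow]
  rw [← Finset.mul_sum, Real.sqrt_mul (by positivity), Real.sqrt_sq hc]

lemma exists_l2norm_eq (hn : 0 < n) (h : Fin n → ℝ) {c : ℝ} (hc : 0 ≤ c) :
    ∃ u : Fin n → ℝ, l2norm u = c ∧ ∑ i, u i * h i = c * l2norm h := by
  by_cases h0 : l2norm h = 0
  · have hz : ∀ i, h i = 0 := by
      have hsum := l2norm_sq h
      rw [h0, zero_pow two_ne_zero, eq_comm,
        Finset.sum_eq_zero_iff_of_nonneg fun _ _ => sq_nonneg _] at hsum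
      exact fun i => pow_eq_zero_iff two_ne_zero |>.1 (hsum i (Finset.mem_univ i))
    refine ⟨Pi.single ⟨0, hn⟩ c, ?_, by simp [hz, h0]⟩
    simp [l2norm, Pi.single_apply, ite_pow, Real.sqrt_sq hc]
  · refine ⟨(c / l2norm h) • h, ?_, ?_⟩
    · rw [l2norm_smul (div_nonneg hc (l2norm_nonneg h)), div_mul_cancel₀ _ h0]
    · simp only [Pi.smul_apply, smul_eq_mul, mul_assoc]
      rw [← Finset.mul_sum, ← l2norm_mul_self]
      field_simp

lemma shiftedCost_eq (X : Fin n → Fin N → ℝ) (z : Fin n → ℝ) (w : Fin N → ℝ) :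
    shiftedCost n N σ lam θ X z w
      = (∑ i, lassoResidual σ X z w i ^ 2) / 2 + lassoPenalty n lam θ w := by
  simp only [shiftedCost, lassoResidual, lassoPenalty, div_pow, Real.sq_sqrt n.cast_nonneg]
  rw [← Finset.sum_div]
  ring

lemma primaryField_apply (w : Fin N → ℝ) (u : Fin n → ℝ) (ω) :
    primaryField n σ w u ω = ∑ i, u i * lassoResidual σ ω.1.1 ω.1.2 w i
      + l2norm u * liftedNorm n σ w / Real.sqrt n * ω.2 := by
  rw [primaryField, primaryForm_apply, ← Finset.sum_add_distrib]
  congr 1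
  refine Finset.sum_congr rfl fun i _ => ?_
  rw [lassoResidual, mul_div_assoc', mul_sub, sub_div, Finset.mul_sum, Finset.sum_div,
    sub_eq_add_neg]
  congr 1
  · exact Finset.sum_congr rfl fun j _ => by ring
  · ring

lemma auxiliaryField_apply (w : Fin N → ℝ) (u : Fin n → ℝ) (ω) :
    auxiliaryField n σ w u ω
      = l2norm u * (ω.2.2 * σ / Real.sqrt n - (1 / (n : ℝ)) * ∑ j, ω.1 j * w j)
        + liftedNorm n σ w / Real.sqrt n * ∑ i, u i * ω.2.1 i := by
  rw [auxiliaryField, auxiliaryForm_apply, mul_sub, Finset.mul_sum, Finset.mul_sum,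
    Finset.mul_sum]
  have h1 : ∑ j, -(l2norm u * w j / n) * ω.1 j
      = -∑ j, l2norm u * ((1 / (n : ℝ)) * (ω.1 j * w j)) := by
    rw [← Finset.sum_neg_distrib]
    exact Finset.sum_congr rfl fun j _ => by ring
  have h2 : ∑ i, liftedNorm n σ w * u i / Real.sqrt n * ω.2.1 i
      = ∑ i, liftedNorm n σ w / Real.sqrt n * (u i * ω.2.1 i) :=
    Finset.sum_congr rfl fun i _ => by ring
  rw [h1, h2, ← Finset.mul_sum]
  ring

lemma gordonL_eq (ω : (Fin N → ℝ) × ((Fin n → ℝ) × ℝ)) (w : Fin N → ℝ) :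
    gordonL n N σ lam θ ω.1 ω.2.1 ω.2.2 w
      = (max (ω.2.2 * σ / Real.sqrt n - (1 / (n : ℝ)) * ∑ j, ω.1 j * w j
          + liftedNorm n σ w / Real.sqrt n * l2norm ω.2.1) 0) ^ 2 / 2 + lassoPenalty n lam θ w := by
  rw [gordonL, lassoPenalty, liftedNorm, l2norm]
  ring_nf

lemma liftedNorm_nonneg (w : Fin N → ℝ) : 0 ≤ liftedNorm n σ w := Real.sqrt_nonneg _

lemma auxiliaryField_add_le_gordonL (ω) (w : Fin N → ℝ) (u : Fin n → ℝ) :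
    auxiliaryField n σ w u ω + minMaxOffset lam θ w u
      ≤ gordonL n N σ lam θ ω.1 ω.2.1 ω.2.2 w := by
  rw [auxiliaryField_apply, gordonL_eq, minMaxOffset, ← l2norm_sq]
  set q := ω.2.2 * σ / Real.sqrt n - (1 / (n : ℝ)) * ∑ j, ω.1 j * w j
  set r := liftedNorm n σ w / Real.sqrt n
  have hr : 0 ≤ r := div_nonneg (liftedNorm_nonneg w) (Real.sqrt_nonneg _)
  have h1 := mul_le_mul_of_nonneg_left (sum_mul_le_l2norm u ω.2.1) hr
  have h2 := mul_le_mul_of_nonneg_left (le_max_left (q + r * l2norm ω.2.1) 0) (l2norm_nonneg u)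
  nlinarith [sq_nonneg (l2norm u - max (q + r * l2norm ω.2.1) 0)]

lemma exists_auxiliaryField_add_eq_gordonL (hn : 0 < n) (ω) (w : Fin N → ℝ) :
    ∃ u : Fin n → ℝ, auxiliaryField n σ w u ω + minMaxOffset lam θ w u
      = gordonL n N σ lam θ ω.1 ω.2.1 ω.2.2 w := by
  simp only [auxiliaryField_apply, gordonL_eq, minMaxOffset, ← l2norm_sq]
  set q := ω.2.2 * σ / Real.sqrt n - (1 / (n : ℝ)) * ∑ j, ω.1 j * w j
  set r := liftedNorm n σ w / Real.sqrt n
  obtain ⟨u, hu, hu'⟩ := exists_l2norm_eq hn ω.2.1 (le_max_right (q + r * l2norm ω.2.1) 0)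
  refine ⟨u, ?_⟩
  rw [hu, hu']
  have : max (q + r * l2norm ω.2.1) 0 * (q + r * l2norm ω.2.1)
      = max (q + r * l2norm ω.2.1) 0 ^ 2 := by
    rcases max_choice (q + r * l2norm ω.2.1) 0 with h | h <;> rw [h] <;> ring
  linear_combination this

lemma le_lassoPenalty (hlam : 0 < lam) (w : Fin N → ℝ) :
    lam / n * (‖w‖ - 2 * ∑ j, |θ j|) ≤ lassoPenalty n lam θ w := by
  have h : ‖w‖ ≤ ∑ j, |w j| := (pi_norm_le_iff_of_nonneg (by positivity)).2 fun j =>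
    Finset.single_le_sum (f := fun j => |w j|) (fun _ _ => abs_nonneg _) (Finset.mem_univ j)
  have h' : ∑ j, |w j| ≤ ∑ j, |w j + θ j| + ∑ j, |θ j| := by
    rw [← Finset.sum_add_distrib]
    refine Finset.sum_le_sum fun j _ => ?_
    simpa using abs_sub (w j + θ j) (θ j)
  rw [lassoPenalty]
  refine mul_le_mul_of_nonneg_left ?_ (by positivity)
  linarith

lemma le_lassoPenalty_of_zero (hlam : 0 < lam) (w : Fin N → ℝ) :
    lam / n * (0 - 2 * ∑ j, |θ j|) ≤ lassoPenalty n lam θ w :=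
  le_trans (by gcongr; exact norm_nonneg w) (le_lassoPenalty hlam w)

lemma bddBelow_gordonL (hlam : 0 < lam) (D : Set (Fin N → ℝ))
    (ω : (Fin N → ℝ) × ((Fin n → ℝ) × ℝ)) :
    BddBelow (gordonL n N σ lam θ ω.1 ω.2.1 ω.2.2 '' D) := by
  refine ⟨lam / n * (0 - 2 * ∑ j, |θ j|), ?_⟩
  rintro _ ⟨w, -, rfl⟩
  rw [gordonL_eq]
  exact (le_lassoPenalty_of_zero hlam w).trans (le_add_of_nonneg_left (by positivity))

lemma exists_sInf_shiftedCost_eq (hn : 0 < n) (hlam : 0 < lam) {D : Set (Fin N → ℝ)}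
    (hD : IsClosed D) (hne : D.Nonempty) (X : Fin n → Fin N → ℝ) (z : Fin n → ℝ) :
    ∃ w ∈ D, sInf (shiftedCost n N σ lam θ X z '' D) = shiftedCost n N σ lam θ X z w ∧
      IsMinOn (shiftedCost n N σ lam θ X z) D w := by
  have hcont : Continuous (shiftedCost n N σ lam θ X z) := by
    unfold shiftedCost
    fun_prop
  have hn' : (0 : ℝ) < n := Nat.cast_pos.2 hn
  have htend : Tendsto (shiftedCost n N σ lam θ X z) (cocompact _) atTop := by
    refine tendsto_atTop_mono (fun w => (le_lassoPenalty hlam w).trans ?_)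
      (Tendsto.const_mul_atTop (div_pos hlam hn')
        (tendsto_atTop_add_const_right _ (-(2 * ∑ j, |θ j|)) tendsto_norm_cocompact_atTop))
    rw [shiftedCost_eq]
    exact le_add_of_nonneg_left (by positivity)
  obtain ⟨w₀, hw₀⟩ := hne
  obtain ⟨w, hw, hmin⟩ := hcont.continuousOn.exists_isMinOn' hD hw₀
    ((htend.eventually_ge_atTop _).filter_mono inf_le_left)
  exact ⟨w, hw, (IsLeast.csInf_eq ⟨⟨w, hw, rfl⟩, by rintro _ ⟨w', hw', rfl⟩; exact hmin hw'⟩),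
    hmin⟩

lemma lassoPenalty_convex_comb (hlam : 0 < lam) (w w' : Fin N → ℝ) {s : ℝ} (hs : 0 ≤ s)
    (hs' : s ≤ 1) :
    lassoPenalty n lam θ ((1 - s) • w + s • w')
      ≤ (1 - s) * lassoPenalty n lam θ w + s * lassoPenalty n lam θ w' := by
  have h : ∑ j, |((1 - s) • w + s • w') j + θ j|
      ≤ (1 - s) * ∑ j, |w j + θ j| + s * ∑ j, |w' j + θ j| := by
    rw [Finset.mul_sum, Finset.mul_sum, ← Finset.sum_add_distrib]
    refine Finset.sum_le_sum fun j _ => ?_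
    have : ((1 - s) • w + s • w') j + θ j = (1 - s) * (w j + θ j) + s * (w' j + θ j) := by
      simp only [Pi.add_apply, Pi.smul_apply, smul_eq_mul]
      ring
    rw [this]
    refine (abs_add_le _ _).trans_eq ?_
    rw [abs_mul, abs_mul, abs_of_nonneg hs, abs_of_nonneg (sub_nonneg.2 hs')]
  have h' := mul_le_mul_of_nonneg_left h (show 0 ≤ lam / (n : ℝ) by positivity)
  simp only [lassoPenalty]
  linarith

lemma lassoResidual_convex_comb (X : Fin n → Fin N → ℝ) (z : Fin n → ℝ) (w w' : Fin N → ℝ) (s : ℝ)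
    (i : Fin n) :
    lassoResidual σ X z ((1 - s) • w + s • w') i
      = lassoResidual σ X z w i + s * (lassoResidual σ X z w' i - lassoResidual σ X z w i) := by
  have : ∑ j, X i j * ((1 - s) • w + s • w') j
      = (1 - s) * ∑ j, X i j * w j + s * ∑ j, X i j * w' j := by
    rw [Finset.mul_sum, Finset.mul_sum, ← Finset.sum_add_distrib]
    refine Finset.sum_congr rfl fun j _ => ?_
    simp only [Pi.add_apply, Pi.smul_apply, smul_eq_mul]
    ring
  simp only [lassoResidual, this]
  ring

lemma shiftedCost_le_of_isMinOn (hlam : 0 < lam) {D : Set (Fin N → ℝ)} (hD : Convex ℝ D)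
    {X : Fin n → Fin N → ℝ} {z : Fin n → ℝ} {w w' : Fin N → ℝ} (hw : w ∈ D) (hw' : w' ∈ D)
    (hmin : IsMinOn (shiftedCost n N σ lam θ X z) D w) :
    shiftedCost n N σ lam θ X z w ≤ ∑ i, lassoResidual σ X z w i * lassoResidual σ X z w' i
      + minMaxOffset lam θ w' (lassoResidual σ X z w) := by
  set v := lassoResidual σ X z w
  set v' := lassoResidual σ X z w'
  let K := ∑ i, (v' i - v i) ^ 2
  let F := ∑ i, v i * (v' i - v i) + lassoPenalty n lam θ w' - lassoPenalty n lam θ w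
  have hs : ∀ s : ℝ, 0 < s → s ≤ 1 → 0 ≤ F + s * (K / 2) := by
    intro s hs hs'
    have hmem : (1 - s) • w + s • w' ∈ D := hD hw hw' (sub_nonneg.2 hs') hs.le (by ring)
    have hle : shiftedCost n N σ lam θ X z w
      ≤ shiftedCost n N σ lam θ X z ((1 - s) • w + s • w') := hmin hmem
    have hpen := lassoPenalty_convex_comb (n := n) (θ := θ) hlam w w' hs.le hs'
    have hexp : ∑ i, lassoResidual σ X z ((1 - s) • w + s • w') i ^ 2
        = ∑ i, v i ^ 2 + 2 * s * ∑ i, v i * (v' i - v i) + s ^ 2 * K := by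
      simp only [K, Finset.mul_sum]
      rw [← Finset.sum_add_distrib, ← Finset.sum_add_distrib]
      refine Finset.sum_congr rfl fun i _ => ?_
      rw [lassoResidual_convex_comb]
      ring
    rw [shiftedCost_eq, shiftedCost_eq, hexp] at hle
    refine nonneg_of_mul_nonneg_right (a := s) ?_ hs
    simp only [F]
    linarith
  have hF : 0 ≤ F := by
    have hlim : Tendsto (fun s : ℝ => F + s * (K / 2)) (𝓝[>] 0) (𝓝 F) := by
      have : Tendsto (fun s : ℝ => F + s * (K / 2)) (𝓝 0) (𝓝 (F + 0 * (K / 2))) :=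
        (continuous_const.add (continuous_id.mul continuous_const)).tendsto 0
      rw [zero_mul, add_zero] at this
      exact this.mono_left nhdsWithin_le_nhds
    refine ge_of_tendsto hlim ?_
    filter_upwards [Ioc_mem_nhdsGT zero_lt_one] with s h using hs s h.1 h.2
  have hsum : ∑ i, v i * (v' i - v i) = ∑ i, v i * v' i - ∑ i, v i ^ 2 := by
    rw [← Finset.sum_sub_distrib]
    exact Finset.sum_congr rfl fun i _ => by ring
  simp only [F, hsum] at hF
  rw [shiftedCost_eq, minMaxOffset]
  linarith

lemma sum_mul_lassoResidual_add_le (X : Fin n → Fin N → ℝ) (z : Fin n → ℝ) (w : Fin N → ℝ)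
    (u : Fin n → ℝ) :
    ∑ i, u i * lassoResidual σ X z w i + minMaxOffset lam θ w u
      ≤ shiftedCost n N σ lam θ X z w := by
  have h : ∑ i, u i * lassoResidual σ X z w i
      ≤ (∑ i, u i ^ 2) / 2 + (∑ i, lassoResidual σ X z w i ^ 2) / 2 := by
    rw [← add_div, ← Finset.sum_add_distrib, Finset.sum_div]
    exact Finset.sum_le_sum fun i _ => by
      linarith [two_mul_le_add_sq (u i) (lassoResidual σ X z w i)]
  rw [shiftedCost_eq, minMaxOffset]
  linarith

end LassoDeterministic

section LassoContinuity

variable {n N : ℕ} {T : Type*} [TopologicalSpace T] {w : T → Fin N → ℝ} {u : T → Fin n → ℝ}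

lemma continuous_primaryField (σ : ℝ) (hw : Continuous w) (hu : Continuous u) (ω) :
    Continuous fun t => primaryField n σ (w t) (u t) ω := by
  simp only [primaryField_apply, lassoResidual, l2norm, liftedNorm]
  fun_prop

lemma continuous_auxiliaryField (σ : ℝ) (hw : Continuous w) (hu : Continuous u)
    {ω : T → (Fin N → ℝ) × ((Fin n → ℝ) × ℝ)} (hω : Continuous ω) :
    Continuous fun t => auxiliaryField n σ (w t) (u t) (ω t) := by
  simp only [auxiliaryField_apply, l2norm, liftedNorm]
  fun_prop

lemma continuous_minMaxOffset (lam : ℝ) (θ : Fin N → ℝ) (hw : Continuous w) (hu : Continuous u) :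
    Continuous fun t => minMaxOffset lam θ (w t) (u t) := by
  simp only [minMaxOffset, lassoPenalty]
  fun_prop

end LassoContinuity

section LassoComparison

variable {n N : ℕ} {lam : ℝ} {D : Set (Fin N → ℝ)}

lemma measure_sInf_shiftedCost_le (hn : 0 < n) (σ : ℝ) (hlam : 0 < lam) (θ : Fin N → ℝ)
    (hD : IsClosed D) (hne : D.Nonempty) (t : ℝ) :
    Pmodel n N {ω | sInf (shiftedCost n N σ lam θ ω.1 ω.2 '' D) ≤ t}
      ≤ 2 * Pgordon n N {ω | sInf (gordonL n N σ lam θ ω.1 ω.2.1 ω.2.2 '' D) ≤ t} := by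
  have : SigmaCompactSpace D := hD.isClosedEmbedding_subtypeVal.sigmaCompactSpace
  have hsym : Pmodel n N {ω | sInf (shiftedCost n N σ lam θ ω.1 ω.2 '' D) ≤ t}
      ≤ 2 * ((Pmodel n N).prod (gaussianReal 0 1))
        {ω | ∃ w : D, ∀ u, primaryField n σ w u ω + minMaxOffset lam θ w u ≤ t} := by
    refine measure_le_two_mul_prod one_le_two_mul_gaussianReal_Iic ?_
    rintro ⟨⟨X, z⟩, ζ⟩ ⟨hle, hζ⟩
    obtain ⟨w, hw, heq, -⟩ := exists_sInf_shiftedCost_eq (σ := σ) (θ := θ) hn hlam hD hne X z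
    refine ⟨⟨w, hw⟩, fun u => ?_⟩
    have h1 : shiftedCost n N σ lam θ X z w ≤ t := heq ▸ hle
    have h2 := sum_mul_lassoResidual_add_le (σ := σ) (lam := lam) (θ := θ) X z w u
    have h3 : l2norm u * liftedNorm n σ w / Real.sqrt n * ζ ≤ 0 :=
      mul_nonpos_of_nonneg_of_nonpos (div_nonneg (mul_nonneg (l2norm_nonneg u)
        (liftedNorm_nonneg w)) (Real.sqrt_nonneg _)) hζ
    rw [primaryField_apply]
    linarith
  refine hsym.trans (mul_le_mul_right ?_ 2)
  refine ((gordonOrder_process n σ D).measure_le (fun w u => minMaxOffset lam θ w u) t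
    (fun u ω => ?_) (fun u => ?_) (fun w ω => ?_)).trans (measure_mono ?_)
  · exact (continuous_primaryField σ continuous_subtype_val continuous_const ω).add
      (continuous_minMaxOffset lam θ continuous_subtype_val continuous_const)
  · exact (continuous_auxiliaryField σ (continuous_subtype_val.comp continuous_fst)
      continuous_const continuous_snd).add
      (continuous_minMaxOffset lam θ (continuous_subtype_val.comp continuous_fst) continuous_const)
  · exact (continuous_auxiliaryField σ continuous_const continuous_id continuous_const).add
      (continuous_minMaxOffset lam θ continuous_const continuous_id)
  · rintro ω ⟨w, hw⟩
    obtain ⟨u, hu⟩ := exists_auxiliaryField_add_eq_gordonL (σ := σ) (lam := lam) (θ := θ) hn ω w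
    exact (csInf_le (bddBelow_gordonL hlam D ω) ⟨w, w.2, rfl⟩).trans (hu ▸ hw u)

lemma measure_le_sInf_shiftedCost (hn : 0 < n) (σ : ℝ) (hlam : 0 < lam) (θ : Fin N → ℝ)
    (hD : IsClosed D) (hne : D.Nonempty) (hconv : Convex ℝ D) (t : ℝ) :
    Pmodel n N {ω | t ≤ sInf (shiftedCost n N σ lam θ ω.1 ω.2 '' D)}
      ≤ 2 * Pgordon n N {ω | t ≤ sInf (gordonL n N σ lam θ ω.1 ω.2.1 ω.2.2 '' D)} := by
  have : Nonempty D := hne.to_subtype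
  have hsym : Pmodel n N {ω | t ≤ sInf (shiftedCost n N σ lam θ ω.1 ω.2 '' D)}
      ≤ 2 * ((Pmodel n N).prod (gaussianReal 0 1))
        {ω | ∃ u, ∀ w : D, -primaryField n σ w u ω + -minMaxOffset lam θ w u ≤ -t} := by
    refine measure_le_two_mul_prod
      (gaussianReal_Ici_zero ▸ one_le_two_mul_gaussianReal_Iic) (T := Set.Ici 0) ?_
    rintro ⟨⟨X, z⟩, ζ⟩ ⟨hle, hζ⟩
    obtain ⟨w, hw, heq, hmin⟩ := exists_sInf_shiftedCost_eq (σ := σ) (θ := θ) hn hlam hD hne X z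
    refine ⟨lassoResidual σ X z w, fun w' => ?_⟩
    have h1 : t ≤ shiftedCost n N σ lam θ X z w := heq ▸ hle
    have h2 := shiftedCost_le_of_isMinOn hlam hconv hw w'.2 hmin
    have h3 : 0 ≤ l2norm (lassoResidual σ X z w) * liftedNorm n σ w'.1 / Real.sqrt n * ζ :=
      mul_nonneg (div_nonneg (mul_nonneg (l2norm_nonneg _) (liftedNorm_nonneg _))
        (Real.sqrt_nonneg _)) hζ
    rw [primaryField_apply]
    linarith
  refine hsym.trans (mul_le_mul_right ?_ 2)
  refine ((gordonOrder_neg_process n σ D).measure_le (fun u w => -minMaxOffset lam θ w u) (-t)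
    (fun w ω => ?_) (fun w => ?_) (fun u ω => ?_)).trans (measure_mono ?_)
  · exact (continuous_primaryField σ continuous_const continuous_id ω).neg.add
      (continuous_minMaxOffset lam θ continuous_const continuous_id).neg
  · exact (continuous_auxiliaryField σ continuous_const continuous_fst continuous_snd).neg.add
      (continuous_minMaxOffset lam θ continuous_const continuous_fst).neg
  · exact (continuous_auxiliaryField σ continuous_subtype_val continuous_const
      continuous_const).neg.add
      (continuous_minMaxOffset lam θ continuous_subtype_val continuous_const).neg
  · rintro ω ⟨u, hu⟩
    change t ≤ sInf _
    refine le_csInf (hne.image _) ?_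
    rintro _ ⟨w, hw, rfl⟩
    have h1 := hu ⟨w, hw⟩
    have h2 := auxiliaryField_add_le_gordonL (σ := σ) (lam := lam) (θ := θ) ω w u
    rw [_root_.neg_apply] at h1
    linarith

end LassoComparison

end GordonComparison

/-- Corollary (Gordon comparison for the Lasso cost and its auxiliary cost). -/
theorem stmt11 (n N : ℕ) (hn : 0 < n) (σ lam : ℝ) (hσ : 0 < σ) (hlam : 0 < lam)
    (θstar : Fin N → ℝ) (D : Set (Fin N → ℝ)) (hDc : IsClosed D)
    (hDne : D.Nonempty) :
    (∀ t : ℝ,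
      Pmodel n N {ω | sInf (shiftedCost n N σ lam θstar ω.1 ω.2 '' D) ≤ t}
        ≤ 2 * Pgordon n N
            {ω | sInf (gordonL n N σ lam θstar ω.1 ω.2.1 ω.2.2 '' D) ≤ t}) ∧
    (Convex ℝ D → ∀ t : ℝ,
      Pmodel n N {ω | t ≤ sInf (shiftedCost n N σ lam θstar ω.1 ω.2 '' D)}
        ≤ 2 * Pgordon n N
            {ω | t ≤ sInf (gordonL n N σ lam θstar ω.1 ω.2.1 ω.2.2 '' D)}) := by
  exact ⟨fun t => measure_sInf_shiftedCost_le hn σ hlam θstar hDc hDne t,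
    fun hconv t => measure_le_sInf_shiftedCost hn σ hlam θstar hDc hDne hconv t⟩
end
end

section
/- The map λ ↦ μ⋆_λ is M-Lipschitz on [λ_min, λ_max] with respect to the Wasserstein distance W₂, for some constant M > 0 depending only on Ω; that is, W₂(μ⋆_{λ₁}, μ⋆_{λ₂}) ≤ M |λ₁ − λ₂| for all λ₁, λ₂ ∈ [λ_min, λ_max]. -/
open MeasureTheory ProbabilityTheory
open scoped ENNReal NNReal

noncomputable section

section SoftThreshold

lemma eta_eq_max_sub_max {b : ℝ} (hb : 0 ≤ b) (x : ℝ) :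
    eta x b = max (x - b) 0 - max (-x - b) 0 := by
  unfold eta
  rcases lt_trichotomy x 0 with hx | hx | hx
  · rw [Real.sign_of_neg hx, abs_of_neg hx, max_eq_right (by linarith : x - b ≤ 0)]
    ring
  · subst hx
    simp [hb]
  · rw [Real.sign_of_pos hx, abs_of_pos hx, max_eq_right (by linarith : -x - b ≤ 0)]
    ring

lemma continuous_eta {b : ℝ} (hb : 0 ≤ b) : Continuous fun x => eta x b := by
  simp only [eta_eq_max_sub_max hb]
  fun_prop

lemma abs_eta_le {b : ℝ} (hb : 0 ≤ b) (x : ℝ) : |eta x b| ≤ |x| := by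
  rw [eta_eq_max_sub_max hb]
  rcases max_cases (x - b) 0 with h | h <;> rcases max_cases (-x - b) 0 with h' | h' <;>
    rcases abs_cases x with h'' | h'' <;> rw [abs_le] <;> constructor <;> linarith

lemma abs_sub_eta_le {b : ℝ} (hb : 0 ≤ b) (x : ℝ) : |x - eta x b| ≤ b := by
  rw [eta_eq_max_sub_max hb]
  rcases max_cases (x - b) 0 with h | h <;> rcases max_cases (-x - b) 0 with h' | h' <;>
    rw [abs_le] <;> constructor <;> linarith

lemma sub_eta_mul_eta {b : ℝ} (hb : 0 ≤ b) (x : ℝ) :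
    (x - eta x b) * eta x b = b * |eta x b| := by
  rw [eta_eq_max_sub_max hb]
  rcases max_cases (x - b) 0 with ⟨h, h1⟩ | ⟨h, h1⟩ <;>
    rcases max_cases (-x - b) 0 with ⟨h', h2⟩ | ⟨h', h2⟩ <;> rw [h, h']
  · have : x = 0 := by linarith
    have : b = 0 := by linarith
    simp [*]
  · rw [abs_of_nonneg (by linarith)]
    ring
  · rw [abs_of_nonpos (by linarith)]
    ring
  · simp

lemma eta'_eq_indicator {b : ℝ} (hb : 0 ≤ b) (x : ℝ) :
    eta' x b = (Set.Ioi b).indicator 1 x + (Set.Ioi b).indicator 1 (-x) := by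
  unfold eta'
  simp only [Set.indicator_apply, Set.mem_Ioi, Pi.one_apply]
  rcases abs_cases x with h | h <;> split_ifs <;> linarith

lemma abs_eta'_le (x b : ℝ) : |eta' x b| ≤ 1 := by
  unfold eta'
  split_ifs <;> simp

end SoftThreshold

section Gaussian

instance : IsProbabilityMeasure stdG := by
  unfold stdG
  infer_instance

lemma gphi_eq_gaussianPDFReal : gphi = gaussianPDFReal 0 1 := by
  ext x
  simp [gphi, gaussianPDFReal]
  field_simp

lemma hasDerivAt_gphi (x : ℝ) : HasDerivAt gphi (-x * gphi x) x := by
  have h : HasDerivAt (fun x : ℝ => Real.exp (-x ^ 2 / 2) / Real.sqrt (2 * Real.pi))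
      (Real.exp (-x ^ 2 / 2) * (-(2 * x) / 2) / Real.sqrt (2 * Real.pi)) x := by
    refine (HasDerivAt.exp ?_).div_const _
    simpa using ((hasDerivAt_pow 2 x).neg.div_const 2)
  exact h.congr_deriv (by unfold gphi; ring)

lemma integrable_stdG_iff {f : ℝ → ℝ} :
    Integrable f stdG ↔ Integrable fun x => gphi x * f x := by
  rw [stdG, gaussianReal_of_var_ne_zero _ one_ne_zero,
    integrable_withDensity_iff_integrable_smul' (measurable_gaussianPDF _ _)
      (ae_of_all _ fun _ => gaussianPDF_lt_top)]
  simp [gphi_eq_gaussianPDFReal]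

lemma setIntegral_stdG {s : Set ℝ} (hs : MeasurableSet s) (f : ℝ → ℝ) :
    ∫ x in s, f x ∂stdG = ∫ x in s, gphi x * f x := by
  rw [← integral_indicator hs, ← integral_indicator hs, stdG,
    integral_gaussianReal_eq_integral_smul one_ne_zero, gphi_eq_gaussianPDFReal]
  congr 1 with x
  by_cases hx : x ∈ s <;> simp [hx]

lemma memLp_id_stdG : MemLp (fun z : ℝ => z) 2 stdG :=
  memLp_id_gaussianReal' 2 (by simp)

lemma integrable_id_stdG : Integrable (fun z : ℝ => z) stdG :=
  memLp_id_stdG.integrable one_le_two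

lemma integrable_sq_stdG : Integrable (fun z : ℝ => z ^ 2) stdG :=
  memLp_id_stdG.integrable_sq

lemma integral_id_stdG : ∫ z, z ∂stdG = 0 := integral_id_gaussianReal

lemma integral_sq_stdG : ∫ z, z ^ 2 ∂stdG = 1 := by
  have h := variance_fun_id_gaussianReal (μ := 0) (v := 1)
  rw [variance_eq_integral measurable_id'.aemeasurable] at h
  simpa [stdG] using h

lemma integral_comp_neg_stdG (f : ℝ → ℝ) : ∫ z, f (-z) ∂stdG = ∫ z, f z ∂stdG := by
  have h : stdG.map (fun x => -x) = stdG := by simp [stdG, gaussianReal_map_neg]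
  have e := (MeasurableEquiv.neg ℝ).measurableEmbedding.integral_map (μ := stdG) f
  rw [show ⇑(MeasurableEquiv.neg ℝ) = fun x : ℝ => -x from rfl, h] at e
  exact e.symm

lemma setIntegral_Ioi_stdG (p q c : ℝ) :
    ∫ z in Set.Ioi c, (p * z ^ 2 + q * z - p) ∂stdG = (p * c + q) * gphi c := by
  have hd : ∀ z ∈ Set.Ici c, HasDerivAt (fun z => -((p * z + q) * gphi z))
      (gphi z * (p * z ^ 2 + q * z - p)) z := by
    intro z _
    have h := ((((hasDerivAt_id z).const_mul p).add_const q).mul (hasDerivAt_gphi z)).neg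
    exact h.congr_deriv (by simp only [id]; ring)
  have hint : Integrable (fun z => gphi z * (p * z ^ 2 + q * z - p)) :=
    integrable_stdG_iff.1 (((integrable_sq_stdG.const_mul p).add
      (integrable_id_stdG.const_mul q)).sub (integrable_const p))
  have hint' : Integrable (fun z => -((p * z + q) * gphi z)) := by
    have := (integrable_stdG_iff.1
      ((integrable_id_stdG.const_mul p).add (integrable_const q))).neg
    refine this.congr (ae_of_all _ fun z => ?_)
    simp only [Pi.neg_apply, Pi.add_apply]
    ring
  have ht := tendsto_zero_of_hasDerivAt_of_integrableOn_Ioi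
    (fun z hz => hd z (Set.mem_Ici_of_Ioi hz)) hint.integrableOn hint'.integrableOn
  rw [setIntegral_stdG measurableSet_Ioi, integral_Ioi_of_hasDerivAt_of_tendsto'
    hd hint.integrableOn ht]
  ring

lemma setIntegral_Ioi_one_stdG (c : ℝ) : ∫ _ in Set.Ioi c, (1 : ℝ) ∂stdG = gPhi (-c) := by
  rw [setIntegral_stdG measurableSet_Ioi, gPhi, ← integral_comp_neg_Ioi]
  simp [gphi]

lemma integral_mul_posPart_stdG {τ : ℝ} (hτ : 0 < τ) (a : ℝ) :
    ∫ z, z * max (a + τ * z) 0 ∂stdG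
      = τ * ∫ z, (Set.Ioi 0).indicator 1 (a + τ * z) ∂stdG := by
  have hmem : ∀ z, 0 < a + τ * z ↔ -a / τ < z := by
    intro z
    rw [div_lt_iff₀ hτ]
    constructor <;> intro h <;> linarith
  have h1 : (fun z => z * max (a + τ * z) 0)
      = (Set.Ioi (-a / τ)).indicator (fun z => (τ * z ^ 2 + a * z - τ) + τ) := by
    ext z
    simp only [Set.indicator_apply, Set.mem_Ioi, ← hmem]
    split_ifs with h
    · rw [max_eq_left h.le]
      ring
    · rw [max_eq_right (not_lt.1 h), mul_zero]
  have h2 : (fun z => (Set.Ioi (0 : ℝ)).indicator (1 : ℝ → ℝ) (a + τ * z))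
      = (Set.Ioi (-a / τ)).indicator (fun _ => 1) := by
    ext z
    simp only [Set.indicator_apply, Set.mem_Ioi, ← hmem, Pi.one_apply]
  rw [h1, h2, integral_indicator measurableSet_Ioi, integral_indicator measurableSet_Ioi,
    integral_add, setIntegral_Ioi_stdG, mul_div_cancel₀ _ hτ.ne']
  · simp [mul_comm]
  · exact (((integrable_sq_stdG.const_mul _).add (integrable_id_stdG.const_mul _)).sub
      (integrable_const _)).integrableOn
  · exact (integrable_const _).integrableOn

/-- Gaussian integration by parts for soft thresholding. -/
lemma integral_mul_eta_stdG {τ b : ℝ} (hτ : 0 < τ) (hb : 0 ≤ b) (θ : ℝ) :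
    ∫ z, z * eta (θ + τ * z) b ∂stdG = τ * ∫ z, eta' (θ + τ * z) b ∂stdG := by
  have hi : ∀ a, Integrable (fun z => z * max (a + τ * z) 0) stdG := fun a =>
    memLp_id_stdG.integrable_mul (q := 2)
      (((memLp_const a).add (memLp_id_stdG.const_mul τ)).pos_part)
  have hj : ∀ a, Integrable
      (fun z => (Set.Ioi (0 : ℝ)).indicator (1 : ℝ → ℝ) (a + τ * z)) stdG := fun a =>
    (integrable_const (1 : ℝ)).mono'
      (((measurable_one.indicator measurableSet_Ioi).comp
        (by fun_prop : Measurable fun z : ℝ => a + τ * z)).aestronglyMeasurable)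
      (ae_of_all _ fun z => by
        simp only [Set.indicator_apply, Pi.one_apply]
        split_ifs <;> simp)
  have e1 : (fun z => z * eta (θ + τ * z) b)
      = fun z => z * max ((θ - b) + τ * z) 0
        + (-z) * max ((-θ - b) + τ * (-z)) 0 := by
    ext z
    rw [eta_eq_max_sub_max hb, show θ + τ * z - b = θ - b + τ * z by ring,
      show -(θ + τ * z) - b = -θ - b + τ * -z by ring]
    ring
  have e2 : (fun z => eta' (θ + τ * z) b)
      = fun z => (Set.Ioi (0 : ℝ)).indicator (1 : ℝ → ℝ) ((θ - b) + τ * z)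
        + (Set.Ioi (0 : ℝ)).indicator (1 : ℝ → ℝ) ((-θ - b) + τ * (-z)) := by
    ext z
    rw [eta'_eq_indicator hb]
    simp only [Set.indicator_apply, Set.mem_Ioi, Pi.one_apply]
    congr 2 <;> rw [eq_iff_iff] <;> constructor <;> intro h <;> linarith
  have hs := fun a => integral_comp_neg_stdG (fun z => z * max (a + τ * z) 0)
  have hs' := fun a => integral_comp_neg_stdG
    (fun z => (Set.Ioi (0 : ℝ)).indicator (1 : ℝ → ℝ) (a + τ * z))
  have hn : ∀ {f : ℝ → ℝ}, Integrable f stdG → Integrable (fun z => f (-z)) stdG := by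
    intro f hf
    have h : stdG.map (fun x => -x) = stdG := by simp [stdG, gaussianReal_map_neg]
    exact Integrable.comp_measurable (h.symm ▸ hf) measurable_neg
  rw [e1, e2, integral_add (hi _) (hn (hi _)), integral_add (hj _) (hn (hj _)), hs, hs',
    integral_mul_posPart_stdG hτ, integral_mul_posPart_stdG hτ, mul_add]

/-- The risk of soft thresholding at the origin, `E[η(Z; α)²]`. -/
def nullRisk (α : ℝ) : ℝ := ∫ z, eta z α ^ 2 ∂stdG

lemma memLp_eta_stdG {α : ℝ} (hα : 0 ≤ α) : MemLp (fun z => eta z α) 2 stdG :=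
  memLp_id_stdG.mono (continuous_eta hα).aestronglyMeasurable
    (ae_of_all _ fun z => abs_eta_le hα z)

lemma nullRisk_nonneg (α : ℝ) : 0 ≤ nullRisk α := integral_nonneg fun _ => sq_nonneg _

lemma nullRisk_le_one {α : ℝ} (hα : 0 ≤ α) : nullRisk α ≤ 1 := by
  rw [← integral_sq_stdG]
  exact integral_mono (memLp_eta_stdG hα).integrable_sq integrable_sq_stdG
    fun z => sq_le_sq.2 (abs_eta_le hα z)

lemma nullRisk_eq {α : ℝ} (hα : 0 ≤ α) :
    nullRisk α = 2 * ((1 + α ^ 2) * gPhi (-α) - α * gphi α) := by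
  have e : (fun z => eta z α ^ 2) = fun z =>
      (Set.Ioi α).indicator (fun z => (1 * z ^ 2 + (-2 * α) * z - 1) + (1 + α ^ 2) * 1) z
      + (Set.Ioi α).indicator (fun z => (1 * z ^ 2 + (-2 * α) * z - 1) + (1 + α ^ 2) * 1) (-z) := by
    ext z
    rw [eta_eq_max_sub_max hα]
    simp only [Set.indicator_apply, Set.mem_Ioi]
    rcases max_cases (z - α) 0 with ⟨h, h1⟩ | ⟨h, h1⟩ <;>
    rcases max_cases (-z - α) 0 with ⟨h', h2⟩ | ⟨h', h2⟩ <;> rw [h, h'] <;>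
    split_ifs <;> nlinarith
  have hi : Integrable (fun z : ℝ => (1 * z ^ 2 + (-2 * α) * z - 1)) stdG :=
    ((integrable_sq_stdG.const_mul _).add (integrable_id_stdG.const_mul _)).sub
      (integrable_const _)
  have hk : Integrable ((Set.Ioi α).indicator
      (fun z => (1 * z ^ 2 + (-2 * α) * z - 1) + (1 + α ^ 2) * 1)) stdG :=
    (hi.add (integrable_const _)).indicator measurableSet_Ioi
  have hk' : Integrable (fun z => (Set.Ioi α).indicator
      (fun z => (1 * z ^ 2 + (-2 * α) * z - 1) + (1 + α ^ 2) * 1) (-z)) stdG := by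
    have h : stdG.map (fun x => -x) = stdG := by simp [stdG, gaussianReal_map_neg]
    exact Integrable.comp_measurable (h.symm ▸ hk) measurable_neg
  rw [nullRisk, e, integral_add hk hk', integral_comp_neg_stdG
    ((Set.Ioi α).indicator (fun z => (1 * z ^ 2 + (-2 * α) * z - 1) + (1 + α ^ 2) * 1)),
    integral_indicator measurableSet_Ioi,
    integral_add hi.integrableOn (integrable_const _).integrableOn,
    setIntegral_Ioi_stdG, integral_const_mul, setIntegral_Ioi_one_stdG]
  ring

lemma tendsto_nullRisk : Filter.Tendsto nullRisk Filter.atTop (nhds 0) := by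
  have h : Filter.Tendsto nullRisk Filter.atTop (nhds (∫ _, (0 : ℝ) ∂stdG)) := by
    refine tendsto_integral_filter_of_dominated_convergence (fun z => z ^ 2) ?_ ?_
      integrable_sq_stdG (ae_of_all _ fun z => ?_)
    · filter_upwards [Filter.eventually_ge_atTop 0] with α hα
      exact ((continuous_eta hα).pow 2).aestronglyMeasurable
    · filter_upwards [Filter.eventually_ge_atTop 0] with α hα
      refine ae_of_all _ fun z => ?_
      rw [Real.norm_of_nonneg (sq_nonneg _)]
      exact sq_le_sq.2 (abs_eta_le hα z)
    · refine tendsto_const_nhds.congr' ?_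
      filter_upwards [Filter.eventually_ge_atTop |z|] with α hα
      simp [eta, hα]
  simpa using h

end Gaussian

section FixedPointGeometry

variable {H : Type*} [NormedAddCommGroup H] [InnerProductSpace ℝ H]

lemma sq_mul_norm_sub_sq_le {w₁ w₂ : H} {δ σ τ₁ τ₂ : ℝ} (hδ : 0 < δ)
    (hτ₁ : 0 < τ₁) (hτ₂ : 0 < τ₂)
    (hw₁ : ‖w₁‖ ^ 2 = δ * (τ₁ ^ 2 - σ ^ 2)) (hw₂ : ‖w₂‖ ^ 2 = δ * (τ₂ ^ 2 - σ ^ 2)) :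
    σ ^ 2 * ‖w₁ - w₂‖ ^ 2
      ≤ 2 * (τ₁ * τ₂) * (δ * (τ₁ * τ₂ - σ ^ 2) - inner ℝ w₁ w₂) := by
  have hcs := real_inner_mul_inner_self_le w₁ w₂
  rw [real_inner_self_eq_norm_sq, real_inner_self_eq_norm_sq, hw₁, hw₂] at hcs
  rw [norm_sub_sq_real, hw₁, hw₂]
  set C := inner ℝ w₁ w₂
  have hd : 0 ≤ δ * (τ₁ ^ 2 - σ ^ 2) - 2 * C + δ * (τ₂ ^ 2 - σ ^ 2) := by
    rw [← hw₁, ← hw₂, ← norm_sub_sq_real]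
    positivity
  have hP : 0 < δ * (τ₁ * τ₂) := by positivity
  have hprod : δ * σ ^ 2 * (δ * (τ₁ ^ 2 - σ ^ 2) - 2 * C + δ * (τ₂ ^ 2 - σ ^ 2))
      ≤ (δ * (τ₁ * τ₂)) ^ 2 - (δ * σ ^ 2 + C) ^ 2 := by
    nlinarith
  have hle : δ * σ ^ 2 + C ≤ δ * (τ₁ * τ₂) := by
    refine (abs_le_of_sq_le_sq' ?_ hP.le).2
    have : 0 ≤ δ * σ ^ 2 * (δ * (τ₁ ^ 2 - σ ^ 2) - 2 * C + δ * (τ₂ ^ 2 - σ ^ 2)) := by positivity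
    linarith
  have hfac : δ * (σ ^ 2 * (δ * (τ₁ ^ 2 - σ ^ 2) - 2 * C + δ * (τ₂ ^ 2 - σ ^ 2)))
      ≤ δ * (2 * (τ₁ * τ₂) * (δ * (τ₁ * τ₂ - σ ^ 2) - C)) := by
    nlinarith [mul_nonneg (sub_nonneg.2 hle) (sub_nonneg.2 hle)]
  exact le_of_mul_le_mul_left hfac hδ

lemma norm_sub_le_of_stationary {w₁ w₂ Z S₁ S₂ : H} {δ σ l₁ l₂ β₁ β₂ τ₁ τ₂ T m : ℝ}
    (hδ : 0 < δ) (hσ : 0 < σ) (hl₁ : 0 < l₁) (hτ₁ : 0 < τ₁) (hτ₂ : 0 < τ₂)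
    (hm : 0 < m) (hβ₁ : m ≤ β₁) (hβ₂ : m ≤ β₂) (hT₁ : τ₁ ≤ T) (hT₂ : τ₂ ≤ T)
    (hS₁ : l₁ • S₁ = β₁ • (Z - τ₁⁻¹ • w₁)) (hS₂ : l₂ • S₂ = β₂ • (Z - τ₂⁻¹ • w₂))
    (hw₁ : ‖w₁‖ ^ 2 = δ * (τ₁ ^ 2 - σ ^ 2)) (hw₂ : ‖w₂‖ ^ 2 = δ * (τ₂ ^ 2 - σ ^ 2))
    (hZ₁ : inner ℝ Z w₁ = δ * (τ₁ - β₁)) (hZ₂ : inner ℝ Z w₂ = δ * (τ₂ - β₂))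
    (hmono : 0 ≤ inner ℝ (S₁ - S₂) (w₁ - w₂)) (hS : ‖S₂‖ ≤ 1) :
    ‖w₁ - w₂‖ ≤ T ^ 3 / (m * σ ^ 2) * |l₁ - l₂| := by
  have hgap := sq_mul_norm_sub_sq_le hδ hτ₁ hτ₂ hw₁ hw₂
  set d := ‖w₁ - w₂‖ with hd
  have hT : 0 < T := hτ₁.trans_le hT₁
  set G := δ * (τ₁ * τ₂ - σ ^ 2) - inner ℝ w₁ w₂ with hG
  have hG0 : 0 ≤ G := by
    have h1 : 0 ≤ σ ^ 2 * d ^ 2 := by positivity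
    have h2 : 0 < 2 * (τ₁ * τ₂) := by positivity
    exact nonneg_of_mul_nonneg_right (h1.trans hgap) h2
  have hlower : -(|l₁ - l₂| * d) ≤ inner ℝ (l₁ • S₁ - l₂ • S₂) (w₁ - w₂) := by
    have e : l₁ • S₁ - l₂ • S₂ = l₁ • (S₁ - S₂) + (l₁ - l₂) • S₂ := by module
    rw [e, inner_add_left, real_inner_smul_left, real_inner_smul_left]
    have h1 : |(l₁ - l₂) * inner ℝ S₂ (w₁ - w₂)| ≤ |l₁ - l₂| * d := by
      rw [abs_mul]
      refine mul_le_mul_of_nonneg_left ((abs_real_inner_le_norm _ _).trans ?_) (abs_nonneg _)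
      exact mul_le_of_le_one_left (norm_nonneg _) hS
    have h2 := mul_nonneg hl₁.le hmono
    linarith [neg_le_of_abs_le h1]
  have hupper : inner ℝ (l₁ • S₁ - l₂ • S₂) (w₁ - w₂)
      = -δ * (β₁ - β₂) ^ 2 - (β₁ / τ₁ + β₂ / τ₂) * G := by
    rw [hS₁, hS₂]
    simp only [inner_sub_left, inner_sub_right, real_inner_smul_left, hZ₁, hZ₂,
      real_inner_self_eq_norm_sq, hw₁, hw₂, real_inner_comm w₁ w₂, hG]
    field_simp
    ring
  have hkey : (β₁ / τ₁ + β₂ / τ₂) * G ≤ |l₁ - l₂| * d := by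
    nlinarith [mul_nonneg hδ.le (sq_nonneg (β₁ - β₂))]
  have hcoef : 2 * m / T ≤ β₁ / τ₁ + β₂ / τ₂ := by
    have h1 : m / T ≤ β₁ / τ₁ := div_le_div₀ (hm.le.trans hβ₁) hβ₁ hτ₁ hT₁
    have h2 : m / T ≤ β₂ / τ₂ := div_le_div₀ (hm.le.trans hβ₂) hβ₂ hτ₂ hT₂
    calc 2 * m / T = m / T + m / T := by ring
      _ ≤ _ := add_le_add h1 h2
  have hττ : τ₁ * τ₂ ≤ T ^ 2 := by
    rw [sq]
    exact mul_le_mul hT₁ hT₂ hτ₂.le hT.le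
  have hGd : σ ^ 2 * d ^ 2 ≤ 2 * T ^ 2 * G :=
    hgap.trans (by gcongr)
  have hfin : m * σ ^ 2 * d ^ 2 ≤ T ^ 3 * |l₁ - l₂| * d := by
    have h1 : 2 * m / T * G ≤ |l₁ - l₂| * d :=
      (mul_le_mul_of_nonneg_right hcoef hG0).trans hkey
    calc m * σ ^ 2 * d ^ 2 = m * (σ ^ 2 * d ^ 2) := by ring
      _ ≤ m * (2 * T ^ 2 * G) := by gcongr
      _ = T ^ 3 * (2 * m / T * G) := by field_simp
      _ ≤ T ^ 3 * (|l₁ - l₂| * d) := by gcongr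
      _ = _ := by ring
  rcases (norm_nonneg (w₁ - w₂)).eq_or_lt with h0 | h0
  · rw [hd, ← h0]
    positivity
  · rw [div_mul_eq_mul_div, le_div_iff₀ (by positivity)]
    refine le_of_mul_le_mul_right ?_ h0
    linarith [hfin]

lemma le_of_le_add_of_sq_le {σ β τ κ C L : ℝ} (hβ : 0 < β) (hσ : 0 ≤ σ) (hκ : κ < 1)
    (hC : 0 ≤ C) (hL : 0 ≤ L) (hτ : (1 - κ) * τ ≤ β + C) (hβ2 : β ^ 2 ≤ β * σ + L * τ) :
    τ ≤ ((1 + σ + L * (1 + C) / (1 - κ)) + C) / (1 - κ) := by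
  have hk : 0 < 1 - κ := by linarith
  have hτβ : τ ≤ (β + C) / (1 - κ) := by
    rw [le_div_iff₀ hk]
    linarith
  have hβle : β ≤ 1 + σ + L * (1 + C) / (1 - κ) := by
    have hpos : 0 ≤ L * (1 + C) / (1 - κ) := by positivity
    rcases le_total β 1 with h | h
    · linarith
    · have h1 : β + C ≤ (1 + C) * β := by nlinarith
      have h2 : β * β ≤ (σ + L * (1 + C) / (1 - κ)) * β := by
        calc β * β = β ^ 2 := (sq β).symm
          _ ≤ β * σ + L * ((β + C) / (1 - κ)) :=
              hβ2.trans (add_le_add_right (mul_le_mul_of_nonneg_left hτβ hL) _)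
          _ ≤ β * σ + L * ((1 + C) * β / (1 - κ)) := by gcongr
          _ = _ := by ring
      have h3 := le_of_mul_le_mul_right h2 hβ
      linarith
  exact hτβ.trans (by gcongr)

lemma mul_inner_of_stationary {w Z S : H} {δ σ l β τ : ℝ} (hτ : 0 < τ)
    (hS : l • S = β • (Z - τ⁻¹ • w)) (hw : ‖w‖ ^ 2 = δ * (τ ^ 2 - σ ^ 2))
    (hZ : inner ℝ Z w = δ * (τ - β)) :
    l * inner ℝ S w = δ * (β * (σ ^ 2 / τ - β)) := by
  rw [← real_inner_smul_left, hS, real_inner_smul_left, inner_sub_left, real_inner_smul_left,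
    real_inner_self_eq_norm_sq, hw, hZ]
  field_simp
  ring

lemma sq_le_of_stationary {w Z S : H} {δ σ l lmax β τ : ℝ} (hδ : 0 < δ) (hσ : 0 < σ)
    (hl : 0 < l) (hl' : l ≤ lmax) (hβ : 0 < β) (hτ : 0 < τ) (hστ : σ ^ 2 / τ ≤ σ)
    (hS : l • S = β • (Z - τ⁻¹ • w)) (hw : ‖w‖ ^ 2 = δ * (τ ^ 2 - σ ^ 2))
    (hZ : inner ℝ Z w = δ * (τ - β)) (hS1 : ‖S‖ ≤ 1) :
    β ^ 2 ≤ β * σ + lmax * (1 + δ⁻¹) * τ := by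
  have hw' : ‖w‖ ≤ (1 + δ) * τ := by
    refine le_of_sq_le_sq ?_ (by positivity)
    rw [hw]
    have h1 : 0 ≤ (1 + δ + δ ^ 2) * τ ^ 2 := by positivity
    have h2 : 0 ≤ δ * σ ^ 2 := by positivity
    linarith
  have h1 : -((1 + δ) * τ) ≤ inner ℝ S w := by
    have := neg_le_of_abs_le ((abs_real_inner_le_norm S w).trans
      (mul_le_of_le_one_left (norm_nonneg _) hS1))
    linarith
  have h2 : -(lmax * ((1 + δ) * τ)) ≤ δ * (β * (σ ^ 2 / τ - β)) := by
    rw [← mul_inner_of_stationary hτ hS hw hZ]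
    have h3 : l * ((1 + δ) * τ) ≤ lmax * ((1 + δ) * τ) := by gcongr
    have h4 := mul_le_mul_of_nonneg_left h1 hl.le
    linarith
  have h3 : δ * (β * (σ ^ 2 / τ)) ≤ δ * (β * σ) := by gcongr
  have h4 : δ * (lmax * (1 + δ⁻¹) * τ) = lmax * ((1 + δ) * τ) := by
    field_simp
    ring
  refine le_of_mul_le_mul_left ?_ hδ
  linarith

lemma mul_le_add_of_stationary {w Z S ζ : H} {δ σ l lmin β τ α C κ : ℝ}
    (hδ : 0 < δ) (hσ : 0 < σ) (hlmin : 0 < lmin) (hl : lmin ≤ l) (hβ : 0 < β) (hτ : 0 < τ)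
    (hα : 0 ≤ α) (hκ : 0 ≤ κ) (hστ : σ ^ 2 / τ ≤ σ)
    (hS : l • S = β • (Z - τ⁻¹ • w)) (hw : ‖w‖ ^ 2 = δ * (τ ^ 2 - σ ^ 2))
    (hZ : inner ℝ Z w = δ * (τ - β)) (hζ : ‖ζ‖ ^ 2 ≤ κ ^ 2 * δ)
    (hdual : inner ℝ Z w ≤ inner ℝ ζ w + α * inner ℝ S w + C) :
    (1 - κ) * τ ≤ β + (α * σ ^ 2 / lmin + C / δ) := by
  have hwn : ‖w‖ ^ 2 ≤ δ * τ ^ 2 := by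
    rw [hw]
    have := mul_nonneg hδ.le (sq_nonneg σ)
    linarith
  have hζw : inner ℝ ζ w ≤ κ * δ * τ := by
    refine (real_inner_le_norm _ _).trans (le_of_sq_le_sq ?_ (by positivity))
    calc (‖ζ‖ * ‖w‖) ^ 2 = ‖ζ‖ ^ 2 * ‖w‖ ^ 2 := by ring
      _ ≤ (κ ^ 2 * δ) * (δ * τ ^ 2) := by gcongr
      _ = _ := by ring
  have hSw : inner ℝ S w ≤ δ * σ ^ 2 / lmin := by
    rw [le_div_iff₀ hlmin]
    rcases le_or_gt (inner ℝ S w) 0 with h | h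
    · exact (mul_nonpos_of_nonpos_of_nonneg h hlmin.le).trans (by positivity)
    · calc inner ℝ S w * lmin ≤ inner ℝ S w * l := by gcongr
        _ = δ * (β * (σ ^ 2 / τ - β)) := by
            rw [mul_comm, mul_inner_of_stationary hτ hS hw hZ]
        _ ≤ δ * σ ^ 2 := by
            gcongr
            nlinarith [sq_nonneg (β - σ), mul_le_mul_of_nonneg_left hστ hβ.le, sq_nonneg β]
  have h1 : δ * (τ - β) ≤ κ * δ * τ + α * (δ * σ ^ 2 / lmin) + C := by
    rw [← hZ]
    have := mul_le_mul_of_nonneg_left hSw hα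
    linarith
  have h2 : α * (δ * σ ^ 2 / lmin) + C = δ * (α * σ ^ 2 / lmin + C / δ) := by
    field_simp
  refine le_of_mul_le_mul_left ?_ hδ
  linarith

end FixedPointGeometry

section L2

variable {Ω : Type*} {mΩ : MeasurableSpace Ω} {P : Measure Ω} {f g : Ω → ℝ}

lemma inner_toLp_toLp (hf : MemLp f 2 P) (hg : MemLp g 2 P) :
    inner ℝ (hf.toLp f) (hg.toLp g) = ∫ x, f x * g x ∂P := by
  rw [L2.inner_def]
  refine integral_congr_ae ?_
  filter_upwards [hf.coeFn_toLp, hg.coeFn_toLp] with x h1 h2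
  rw [h1, h2]
  simp [mul_comm]

lemma norm_toLp_sq (hf : MemLp f 2 P) : ‖hf.toLp f‖ ^ 2 = ∫ x, f x ^ 2 ∂P := by
  rw [← real_inner_self_eq_norm_sq, inner_toLp_toLp]
  simp only [sq]

lemma integrable_mul_of_memLp_two (hf : MemLp f 2 P) (hg : MemLp g 2 P) :
    Integrable (fun x => f x * g x) P :=
  hf.integrable_mul hg

lemma norm_toLp_le_one [IsProbabilityMeasure P] (hf : MemLp f 2 P) (h : ∀ x, |f x| ≤ 1) :
    ‖hf.toLp f‖ ≤ 1 := by
  have h1 : ‖hf.toLp f‖ ^ 2 ≤ 1 := by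
    rw [norm_toLp_sq]
    calc ∫ x, f x ^ 2 ∂P ≤ ∫ _, (1 : ℝ) ∂P :=
          integral_mono hf.integrable_sq (integrable_const _) fun x => by
            have := (sq_le_one_iff_abs_le_one (f x)).2 (h x)
            exact this
      _ = 1 := by simp
  exact (sq_le_one_iff₀ (norm_nonneg _)).1 h1

end L2

section StateEvolution

/-- The estimation error `η(Θ + τZ; b) - Θ` as a function of `(Θ, Z)`. -/
def shrinkErr (τ b : ℝ) (q : ℝ × ℝ) : ℝ := eta (q.1 + τ * q.2) b - q.1

/-- The subgradient of the absolute value at `η(Θ + τZ; b)`, as a function of `(Θ, Z)`. -/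
def shrinkSubgrad (τ b : ℝ) (q : ℝ × ℝ) : ℝ :=
  (q.1 + τ * q.2 - eta (q.1 + τ * q.2) b) / b

lemma abs_shrinkSubgrad_le {b : ℝ} (hb : 0 < b) (τ : ℝ) (q : ℝ × ℝ) :
    |shrinkSubgrad τ b q| ≤ 1 := by
  rw [shrinkSubgrad, abs_div, abs_of_pos hb, div_le_one hb]
  exact abs_sub_eta_le hb.le _

lemma shrinkSubgrad_mul_eta {b : ℝ} (hb : 0 < b) (τ : ℝ) (q : ℝ × ℝ) :
    shrinkSubgrad τ b q * eta (q.1 + τ * q.2) b = |eta (q.1 + τ * q.2) b| := by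
  rw [shrinkSubgrad, div_mul_eq_mul_div, sub_eta_mul_eta hb.le, mul_div_cancel_left₀ _ hb.ne']

lemma shrinkSubgrad_monotone {b₁ b₂ : ℝ} (hb₁ : 0 < b₁) (hb₂ : 0 < b₂) (τ₁ τ₂ : ℝ)
    (q : ℝ × ℝ) :
    0 ≤ (shrinkSubgrad τ₁ b₁ q - shrinkSubgrad τ₂ b₂ q)
      * (shrinkErr τ₁ b₁ q - shrinkErr τ₂ b₂ q) := by
  have e₁ := shrinkSubgrad_mul_eta hb₁ τ₁ q
  have e₂ := shrinkSubgrad_mul_eta hb₂ τ₂ q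
  have cross : ∀ s v : ℝ, |s| ≤ 1 → s * v ≤ |v| := fun s v hs =>
    (le_abs_self _).trans (by rw [abs_mul]; exact mul_le_of_le_one_left (abs_nonneg _) hs)
  have c₁ := cross _ (eta (q.1 + τ₂ * q.2) b₂) (abs_shrinkSubgrad_le hb₁ τ₁ q)
  have c₂ := cross _ (eta (q.1 + τ₁ * q.2) b₁) (abs_shrinkSubgrad_le hb₂ τ₂ q)
  unfold shrinkErr
  linarith

lemma StateEvo.integral_shrinkErr_sq {δ σ l β τ : ℝ} {μ : Measure ℝ} (hδ : 0 < δ)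
    (h : StateEvo δ σ μ l β τ) :
    ∫ q, shrinkErr τ (τ * l / β) q ^ 2 ∂(μ.prod stdG) = δ * (τ ^ 2 - σ ^ 2) := by
  rw [h.2.2.1]
  unfold shrinkErr
  field_simp
  ring

lemma StateEvo.le_tau {δ σ l β τ : ℝ} {μ : Measure ℝ} (hδ : 0 < δ) (h : StateEvo δ σ μ l β τ) :
    σ ≤ τ := by
  have h1 : 0 ≤ δ * (τ ^ 2 - σ ^ 2) := by
    rw [← h.integral_shrinkErr_sq hδ]
    exact integral_nonneg fun _ => sq_nonneg _
  have := nonneg_of_mul_nonneg_right h1 hδ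
  exact le_of_sq_le_sq (by linarith) h.2.1.le

lemma StateEvo.sq_div_tau_le {δ σ l β τ : ℝ} {μ : Measure ℝ} (hδ : 0 < δ) (hσ : 0 < σ)
    (h : StateEvo δ σ μ l β τ) : σ ^ 2 / τ ≤ σ := by
  rw [div_le_iff₀ h.2.1, sq]
  exact mul_le_mul_of_nonneg_left (h.le_tau hδ) hσ.le

lemma W2_muStar_le {μ : Measure ℝ} {τ₁ α₁ τ₂ α₂ : ℝ} (h₁ : 0 ≤ α₁ * τ₁) (h₂ : 0 ≤ α₂ * τ₂) :
    W2 (muStar μ τ₁ α₁) (muStar μ τ₂ α₂)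
      ≤ Real.sqrt (∫ q, (shrinkErr τ₁ (α₁ * τ₁) q - shrinkErr τ₂ (α₂ * τ₂) q) ^ 2
        ∂(μ.prod stdG)) := by
  have hmeas : ∀ {τ b : ℝ}, 0 ≤ b →
      Measurable fun q : ℝ × ℝ => (eta (q.1 + τ * q.2) b, q.1) := fun {τ b} hb =>
    ((continuous_eta hb).measurable.comp
      (by fun_prop : Measurable fun q : ℝ × ℝ => q.1 + τ * q.2)).prodMk measurable_fst
  refine Real.sqrt_le_sqrt (csInf_le ⟨0, ?_⟩ ⟨(μ.prod stdG).map fun q =>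
    ((eta (q.1 + τ₁ * q.2) (α₁ * τ₁), q.1), (eta (q.1 + τ₂ * q.2) (α₂ * τ₂), q.1)),
    ?_, ?_, ?_⟩)
  · rintro r ⟨γ, -, -, rfl⟩
    exact integral_nonneg fun _ => by positivity
  · rw [Measure.map_map measurable_fst ((hmeas h₁).prodMk (hmeas h₂))]
    rfl
  · rw [Measure.map_map measurable_snd ((hmeas h₁).prodMk (hmeas h₂))]
    rfl
  · rw [integral_map ((hmeas h₁).prodMk (hmeas h₂)).aemeasurable
      (Continuous.aestronglyMeasurable (by fun_prop))]
    refine integral_congr_ae (ae_of_all _ fun q => ?_)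
    simp only [shrinkErr]
    ring

variable {μ : Measure ℝ} [IsProbabilityMeasure μ]

lemma memLp_snd_prod_stdG : MemLp (fun q : ℝ × ℝ => q.2) 2 (μ.prod stdG) :=
  memLp_id_stdG.comp_snd μ

lemma memLp_eta_prod_stdG (hμ : MemLp (fun x : ℝ => x) 2 μ) {b : ℝ} (hb : 0 ≤ b) (τ : ℝ) :
    MemLp (fun q : ℝ × ℝ => eta (q.1 + τ * q.2) b) 2 (μ.prod stdG) :=
  ((hμ.comp_fst stdG).add (memLp_snd_prod_stdG.const_mul τ)).mono
    ((continuous_eta hb).comp (by fun_prop : Continuous fun q : ℝ × ℝ =>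
      q.1 + τ * q.2)).aestronglyMeasurable
    (ae_of_all _ fun _ => abs_eta_le hb _)

lemma memLp_shrinkErr (hμ : MemLp (fun x : ℝ => x) 2 μ) {b : ℝ} (hb : 0 ≤ b) (τ : ℝ) :
    MemLp (shrinkErr τ b) 2 (μ.prod stdG) :=
  (memLp_eta_prod_stdG hμ hb τ).sub (hμ.comp_fst stdG)

lemma memLp_shrinkSubgrad {b : ℝ} (hb : 0 < b) (τ : ℝ) :
    MemLp (shrinkSubgrad τ b) 2 (μ.prod stdG) := by
  refine MemLp.of_bound (Continuous.aestronglyMeasurable ?_) 1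
    (ae_of_all _ fun q => abs_shrinkSubgrad_le hb τ q)
  have hc : Continuous fun q : ℝ × ℝ => q.1 + τ * q.2 := by fun_prop
  exact (hc.sub ((continuous_eta hb.le).comp hc)).div_const b

lemma integrable_eta'_prod_stdG (b τ : ℝ) :
    Integrable (fun q : ℝ × ℝ => eta' (q.1 + τ * q.2) b) (μ.prod stdG) := by
  refine (integrable_const (1 : ℝ)).mono' (Measurable.aestronglyMeasurable ?_)
    (ae_of_all _ fun q => abs_eta'_le _ _)
  unfold eta'
  exact Measurable.ite (measurableSet_lt measurable_const (by fun_prop)) measurable_const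
    measurable_const

lemma integral_snd_mul_shrinkErr (hμ : MemLp (fun x : ℝ => x) 2 μ) {τ b : ℝ} (hτ : 0 < τ)
    (hb : 0 ≤ b) :
    ∫ q : ℝ × ℝ, q.2 * shrinkErr τ b q ∂(μ.prod stdG)
      = τ * ∫ q : ℝ × ℝ, eta' (q.1 + τ * q.2) b ∂(μ.prod stdG) := by
  have hi := integrable_mul_of_memLp_two (memLp_snd_prod_stdG (μ := μ))
    (memLp_eta_prod_stdG hμ hb τ)
  have hj := integrable_mul_of_memLp_two (memLp_snd_prod_stdG (μ := μ)) (hμ.comp_fst stdG)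
  have e : (fun q : ℝ × ℝ => q.2 * shrinkErr τ b q)
      = fun q => q.2 * eta (q.1 + τ * q.2) b - q.2 * q.1 := by
    ext q
    unfold shrinkErr
    ring
  have hz : ∫ q : ℝ × ℝ, q.2 * q.1 ∂(μ.prod stdG) = 0 := by
    simp only [mul_comm]
    rw [integral_prod_mul (fun x : ℝ => x) (fun z : ℝ => z), integral_id_stdG, mul_zero]
  rw [e, integral_sub hi hj, hz, sub_zero, integral_prod _ hi,
    integral_prod _ (integrable_eta'_prod_stdG b τ), ← integral_const_mul]
  simp only [integral_mul_eta_stdG hτ hb]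

lemma smul_shrinkSubgrad_eq (hμ : MemLp (fun x : ℝ => x) 2 μ) {l β τ : ℝ} (hl : 0 < l)
    (hβ : 0 < β) (hτ : 0 < τ) (hb : 0 < τ * l / β) :
    l • (memLp_shrinkSubgrad (μ := μ) hb τ).toLp _
      = β • (memLp_snd_prod_stdG.toLp _
        - τ⁻¹ • (memLp_shrinkErr hμ hb.le τ).toLp _) := by
  rw [← MemLp.toLp_const_smul, ← MemLp.toLp_const_smul, ← MemLp.toLp_sub,
    ← MemLp.toLp_const_smul]
  congr 1
  ext q
  simp only [Pi.smul_apply, Pi.sub_apply, smul_eq_mul, shrinkSubgrad, shrinkErr]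
  field_simp
  ring

lemma StateEvo.integral_snd_mul_shrinkErr {δ σ l β τ : ℝ} (hδ : 0 < δ) (hl : 0 < l)
    (hμ : MemLp (fun x : ℝ => x) 2 μ) (h : StateEvo δ σ μ l β τ) :
    ∫ q : ℝ × ℝ, q.2 * shrinkErr τ (τ * l / β) q ∂(μ.prod stdG) = δ * (τ - β) := by
  obtain ⟨hβ, hτ, -, h2⟩ := h
  rw [_root_.integral_snd_mul_shrinkErr hμ hτ (by positivity)]
  generalize ∫ q : ℝ × ℝ, eta' (q.1 + τ * q.2) (τ * l / β) ∂(μ.prod stdG) = I at h2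
  subst h2
  field_simp
  ring

/-- The dual certificate: the noise minus `α` times a subgradient of the `ℓ¹` norm
at `Θ 1_{|Θ| > K}`. -/
def dualResidual (α K : ℝ) (q : ℝ × ℝ) : ℝ :=
  if K < |q.1| then q.2 - α * Real.sign q.1 else eta q.2 α

lemma measurable_sign : Measurable Real.sign := by
  unfold Real.sign
  exact Measurable.ite measurableSet_Iio measurable_const
    (Measurable.ite measurableSet_Ioi measurable_const measurable_const)

lemma memLp_dualResidual {α : ℝ} (hα : 0 ≤ α) (K : ℝ) :
    MemLp (dualResidual α K) 2 (μ.prod stdG) := by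
  have hsign : ∀ x, |Real.sign x| ≤ 1 := fun x => by
    rcases Real.sign_apply_eq x with h | h | h <;> simp [h]
  refine (memLp_snd_prod_stdG.norm.add (memLp_const α)).mono
    (Measurable.aestronglyMeasurable ?_) (ae_of_all _ fun q => ?_)
  · unfold dualResidual
    exact Measurable.ite (measurableSet_lt measurable_const (by fun_prop))
      (measurable_snd.sub ((measurable_sign.comp measurable_fst).const_mul α))
      ((continuous_eta hα).measurable.comp measurable_snd)
  · refine le_trans ?_ (le_abs_self _)
    simp only [Pi.add_apply, Real.norm_eq_abs, dualResidual]
    split_ifs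
    · refine (abs_sub _ _).trans (add_le_add_right ?_ _)
      rw [abs_mul, abs_of_nonneg hα]
      exact mul_le_of_le_one_right hα (hsign _)
    · exact (abs_eta_le hα _).trans (by linarith)

lemma snd_mul_shrinkErr_le {α K b : ℝ} (hα : 0 ≤ α) (hK : 0 ≤ K) (hb : 0 < b) (τ : ℝ)
    (q : ℝ × ℝ) :
    q.2 * shrinkErr τ b q ≤ dualResidual α K q * shrinkErr τ b q
      + α * (shrinkSubgrad τ b q * shrinkErr τ b q) + 2 * α * K := by
  have hS := shrinkSubgrad_mul_eta hb τ q
  have hS' : shrinkSubgrad τ b q * q.1 ≤ |q.1| :=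
    (le_abs_self _).trans (by
      rw [abs_mul]
      exact mul_le_of_le_one_left (abs_nonneg _) (abs_shrinkSubgrad_le hb τ q))
  have hSw : |eta (q.1 + τ * q.2) b| - |q.1| ≤ shrinkSubgrad τ b q * shrinkErr τ b q := by
    rw [shrinkErr, mul_sub, hS]
    linarith
  refine le_trans ?_ (add_le_add_left (add_le_add_right
    (mul_le_mul_of_nonneg_left hSw hα) _) _)
  unfold dualResidual shrinkErr
  set v := eta (q.1 + τ * q.2) b
  split_ifs with h
  · have h1 : Real.sign q.1 * q.1 = |q.1| := by
      rcases lt_trichotomy q.1 0 with hx | hx | hx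
      · rw [Real.sign_of_neg hx, abs_of_neg hx, neg_one_mul]
      · simp [hx]
      · rw [Real.sign_of_pos hx, abs_of_pos hx, one_mul]
    have h2 : Real.sign q.1 * v ≤ |v| := by
      rcases Real.sign_apply_eq q.1 with hx | hx | hx <;> rw [hx]
      · linarith [neg_abs_le v]
      · simp
      · linarith [le_abs_self v]
    have h3 : α * (Real.sign q.1 * v - Real.sign q.1 * q.1) ≤ α * (|v| - |q.1|) :=
      mul_le_mul_of_nonneg_left (by linarith) hα
    nlinarith [mul_nonneg hα hK]
  · have h1 : (q.2 - eta q.2 α) * (v - q.1) ≤ α * (|v| + |q.1|) := by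
      refine (le_abs_self _).trans ?_
      rw [abs_mul]
      exact mul_le_mul (abs_sub_eta_le hα _) (abs_sub _ _) (abs_nonneg _) hα
    have h2 : α * |q.1| ≤ α * K := mul_le_mul_of_nonneg_left (not_lt.1 h) hα
    linarith

lemma integral_dualResidual_sq_le {α K ε : ℝ} (hα : 0 ≤ α)
    (hε : μ.real {x | K < |x|} ≤ ε) :
    ∫ q, dualResidual α K q ^ 2 ∂(μ.prod stdG)
      ≤ nullRisk α + ε * (1 + α ^ 2 - nullRisk α) := by
  have hR := nullRisk_le_one hα
  have hms : MeasurableSet {x : ℝ | K < |x|} :=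
    measurableSet_lt measurable_const (by fun_prop)
  have hint := (memLp_dualResidual (μ := μ) hα K).integrable_sq
  have hinner : ∀ x, ∫ z, dualResidual α K (x, z) ^ 2 ∂stdG ≤ nullRisk α
      + {x : ℝ | K < |x|}.indicator (fun _ => 1 + α ^ 2 - nullRisk α) x := by
    intro x
    simp only [dualResidual, Set.indicator_apply, Set.mem_ofPred_eq]
    split_ifs
    · have e : (fun z => (z - α * Real.sign x) ^ 2)
          = fun z => z ^ 2 + (-2 * α * Real.sign x) * z + α ^ 2 * Real.sign x ^ 2 := by
        ext z
        ring
      have hs : Real.sign x ^ 2 ≤ 1 := by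
        rcases Real.sign_apply_eq x with h | h | h <;> simp [h]
      have hi : Integrable (fun z => z ^ 2 + (-2 * α * Real.sign x) * z) stdG :=
        integrable_sq_stdG.add (integrable_id_stdG.const_mul _)
      rw [e, integral_add hi (integrable_const _),
        integral_add integrable_sq_stdG (integrable_id_stdG.const_mul _),
        integral_const_mul, integral_id_stdG, integral_sq_stdG]
      simp only [mul_zero, add_zero, integral_const, probReal_univ, one_smul]
      nlinarith [sq_nonneg α]
    · simp [nullRisk]
  rw [integral_prod _ hint]
  calc ∫ x, ∫ z, dualResidual α K (x, z) ^ 2 ∂stdG ∂μ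
      ≤ ∫ x, (nullRisk α
        + {x : ℝ | K < |x|}.indicator (fun _ => 1 + α ^ 2 - nullRisk α) x) ∂μ :=
        integral_mono hint.integral_prod_left
          ((integrable_const _).add ((integrable_const _).indicator hms)) hinner
    _ = nullRisk α + μ.real {x | K < |x|} * (1 + α ^ 2 - nullRisk α) := by
        rw [integral_add (integrable_const _) ((integrable_const _).indicator hms),
          integral_indicator hms]
        simp
    _ ≤ _ := by
        have : 0 ≤ 1 + α ^ 2 - nullRisk α := by nlinarith [sq_nonneg α]
        gcongr

/-- Uniform upper bound on the effective noise level. -/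
lemma exists_tau_le {δ σ lmin lmax α K ε : ℝ} (hδ : 0 < δ) (hσ : 0 < σ) (hlmin : 0 < lmin)
    (hα : 0 ≤ α) (hK : 0 ≤ K) (hε : 0 ≤ ε)
    (hrisk : nullRisk α + ε * (1 + α ^ 2 - nullRisk α) < δ) :
    ∃ T : ℝ, ∀ (μ : Measure ℝ) [IsProbabilityMeasure μ], MemLp (fun x : ℝ => x) 2 μ →
      μ.real {x | K < |x|} ≤ ε → ∀ l ∈ Set.Icc lmin lmax, ∀ β τ : ℝ,
      StateEvo δ σ μ l β τ → τ ≤ T := by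
  set R := nullRisk α + ε * (1 + α ^ 2 - nullRisk α) with hRdef
  have hR : 0 ≤ R := by
    have h1 := nullRisk_nonneg α
    have : 0 ≤ 1 + α ^ 2 - nullRisk α := by nlinarith [sq_nonneg α, nullRisk_le_one hα]
    positivity
  refine ⟨((1 + σ + lmax * (1 + δ⁻¹) * (1 + (α * σ ^ 2 / lmin + 2 * α * K / δ))
      / (1 - Real.sqrt (R / δ)))
    + (α * σ ^ 2 / lmin + 2 * α * K / δ)) / (1 - Real.sqrt (R / δ)),
    fun μ _ hμ hμε l hl β τ h => ?_⟩
  have hl0 : 0 < l := hlmin.trans_le hl.1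
  have hβ := h.1
  have hτ := h.2.1
  have hb : 0 < τ * l / β := by positivity
  have hZ := memLp_snd_prod_stdG (μ := μ)
  have hw := memLp_shrinkErr hμ hb.le τ
  have hS := memLp_shrinkSubgrad (μ := μ) hb τ
  have hζ := memLp_dualResidual (μ := μ) hα K
  have hSeq := smul_shrinkSubgrad_eq hμ hl0 hβ hτ hb
  have hwnorm : ‖hw.toLp _‖ ^ 2 = δ * (τ ^ 2 - σ ^ 2) := by
    rw [norm_toLp_sq, h.integral_shrinkErr_sq hδ]
  have hZw : inner ℝ (hZ.toLp _) (hw.toLp _) = δ * (τ - β) := by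
    rw [inner_toLp_toLp, h.integral_snd_mul_shrinkErr hδ hl0 hμ]
  have hζnorm : ‖hζ.toLp _‖ ^ 2 ≤ Real.sqrt (R / δ) ^ 2 * δ := by
    rw [norm_toLp_sq, Real.sq_sqrt (by positivity), div_mul_cancel₀ _ hδ.ne']
    exact integral_dualResidual_sq_le hα hμε
  have hdual : inner ℝ (hZ.toLp _) (hw.toLp _) ≤ inner ℝ (hζ.toLp _) (hw.toLp _)
      + α * inner ℝ (hS.toLp _) (hw.toLp _) + 2 * α * K := by
    rw [inner_toLp_toLp, inner_toLp_toLp, inner_toLp_toLp]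
    have hi := integrable_mul_of_memLp_two hζ hw
    have hj := (integrable_mul_of_memLp_two hS hw).const_mul α
    have hij : Integrable (fun q => dualResidual α K q * shrinkErr τ (τ * l / β) q
        + α * (shrinkSubgrad τ (τ * l / β) q * shrinkErr τ (τ * l / β) q)) (μ.prod stdG) :=
      hi.add hj
    calc ∫ q : ℝ × ℝ, q.2 * shrinkErr τ (τ * l / β) q ∂(μ.prod stdG)
        ≤ ∫ q, (dualResidual α K q * shrinkErr τ (τ * l / β) q
          + α * (shrinkSubgrad τ (τ * l / β) q * shrinkErr τ (τ * l / β) q) + 2 * α * K)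
            ∂(μ.prod stdG) :=
          integral_mono (integrable_mul_of_memLp_two hZ hw)
            (hij.add (integrable_const _)) (snd_mul_shrinkErr_le hα hK hb τ)
      _ = _ := by
          rw [integral_add hij (integrable_const _), integral_add hi hj,
            integral_const_mul]
          simp
  have hστ := h.sq_div_tau_le hδ hσ
  refine le_of_le_add_of_sq_le (κ := Real.sqrt (R / δ)) (C := α * σ ^ 2 / lmin + 2 * α * K / δ)
    hβ hσ.le ?_ (by positivity) ?_
    (mul_le_add_of_stationary hδ hσ hlmin hl.1 hβ hτ hα (Real.sqrt_nonneg _) hστ hSeq hwnorm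
      hZw hζnorm hdual)
    (sq_le_of_stationary hδ hσ hl0 hl.2 hβ hτ hστ hSeq hwnorm hZw
      (norm_toLp_le_one hS (abs_shrinkSubgrad_le hb τ)))
  · rw [Real.sqrt_lt' one_pos, one_pow, div_lt_one hδ]
    exact hrisk
  · have : 0 ≤ lmax := hl0.le.trans hl.2
    positivity

/-- Uniform lower bound on the effective regularization. -/
lemma exists_le_beta {δ σ lmin lmax K ε : ℝ} (hδ : 0 < δ) (hσ : 0 < σ) (hlmin : 0 < lmin)
    (hK : 0 ≤ K) (hεδ : ε < δ) :
    ∃ m : ℝ, 0 < m ∧ ∀ (μ : Measure ℝ) [IsProbabilityMeasure μ],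
      μ.real {x | K < |x|} ≤ ε → ∀ l ∈ Set.Icc lmin lmax, ∀ β τ : ℝ,
      StateEvo δ σ μ l β τ → m ≤ β := by
  set c := Real.sqrt (2 / (δ - ε)) with hc
  have hgap : 0 < δ - ε := sub_pos.2 hεδ
  have hc0 : 0 < c := Real.sqrt_pos.2 (by positivity)
  have hc2 : 1 / c ^ 2 = (δ - ε) / 2 := by
    rw [hc, Real.sq_sqrt (by positivity), one_div_div]
  refine ⟨min (lmin / (c + K / σ)) (σ * ((δ - ε) / (2 * δ))),
    lt_min (by positivity) (by positivity), fun μ _ hμε l hl β τ h => ?_⟩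
  have hστ := h.le_tau hδ
  obtain ⟨hβ, hτ, -, h2⟩ := h
  have hl0 : 0 < l := hlmin.trans_le hl.1
  have hden : 0 < c + K / σ := by positivity
  rcases le_or_gt (c + K / σ) (l / β) with hcase | hcase
  · refine (min_le_right _ _).trans ?_
    have hms : MeasurableSet {x : ℝ | K < |x|} :=
      measurableSet_lt measurable_const (by fun_prop)
    have hpt : ∀ q : ℝ × ℝ, eta' (q.1 + τ * q.2) (τ * l / β)
        ≤ {x : ℝ | K < |x|}.indicator (fun _ => 1) q.1 + 1 / c ^ 2 * q.2 ^ 2 := by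
      intro q
      have hnn : 0 ≤ 1 / c ^ 2 * q.2 ^ 2 := by positivity
      simp only [eta', Set.indicator_apply, Set.mem_ofPred_eq]
      split_ifs with h1 h2 h2
      · linarith
      · have h3 : c ≤ |q.2| := by
          by_contra! h4
          have h5 : |q.1 + τ * q.2| ≤ K + τ * c := by
            refine (abs_add_le _ _).trans (add_le_add (not_lt.1 h2) ?_)
            rw [abs_mul, abs_of_pos hτ]
            exact mul_le_mul_of_nonneg_left h4.le hτ.le
          have h6 : K ≤ τ * (K / σ) := by
            rw [mul_div_assoc', le_div_iff₀ hσ]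
            nlinarith
          have h7 : τ * (c + K / σ) ≤ τ * l / β := by
            rw [mul_div_assoc]
            exact mul_le_mul_of_nonneg_left hcase hτ.le
          linarith
        rw [zero_add, one_div_mul_eq_div, le_div_iff₀ (by positivity), one_mul, ← sq_abs q.2]
        gcongr
      · linarith
      · linarith
    have hi1 : Integrable (fun q : ℝ × ℝ => {x : ℝ | K < |x|}.indicator
        (fun _ => (1 : ℝ)) q.1) (μ.prod stdG) :=
      Integrable.comp_fst ((integrable_const _).indicator hms) stdG
    have hi2 : Integrable (fun q : ℝ × ℝ => 1 / c ^ 2 * q.2 ^ 2) (μ.prod stdG) :=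
      Integrable.comp_snd (integrable_sq_stdG.const_mul _) μ
    have hI : ∫ q : ℝ × ℝ, eta' (q.1 + τ * q.2) (τ * l / β) ∂(μ.prod stdG)
        ≤ ε + (δ - ε) / 2 := by
      refine (integral_mono (integrable_eta'_prod_stdG _ τ) (hi1.add hi2)
        hpt).trans ?_
      rw [integral_add' hi1 hi2,
        integral_fun_fst (fun x => {x : ℝ | K < |x|}.indicator (fun _ => (1 : ℝ)) x),
        integral_fun_snd (fun z : ℝ => 1 / c ^ 2 * z ^ 2), integral_const_mul,
        integral_sq_stdG, hc2, integral_indicator hms]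
      simpa using hμε
    have hfac : (δ - ε) / (2 * δ)
        ≤ 1 - 1 / δ * ∫ q : ℝ × ℝ, eta' (q.1 + τ * q.2) (τ * l / β) ∂(μ.prod stdG) := by
      calc (δ - ε) / (2 * δ) = 1 - 1 / δ * (ε + (δ - ε) / 2) := by
            field_simp
            ring
        _ ≤ _ := by gcongr
    have hstep := mul_le_mul hστ hfac (by positivity) hτ.le
    rwa [← h2] at hstep
  · refine (min_le_left _ _).trans ?_
    rw [div_le_iff₀ hden]
    rw [div_lt_iff₀ hβ] at hcase
    linarith [hl.1]

lemma exists_lipschitz_W2_muStar {δ σ lmin lmax α K ε : ℝ} (hδ : 0 < δ) (hσ : 0 < σ)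
    (hlmin : 0 < lmin) (hα : 0 ≤ α) (hK : 0 ≤ K) (hε : 0 ≤ ε) (hεδ : ε < δ)
    (hrisk : nullRisk α + ε * (1 + α ^ 2 - nullRisk α) < δ) :
    ∃ M : ℝ, 0 < M ∧ ∀ (μ : Measure ℝ) [IsProbabilityMeasure μ],
      MemLp (fun x : ℝ => x) 2 μ → μ.real {x | K < |x|} ≤ ε →
      ∀ l₁ ∈ Set.Icc lmin lmax, ∀ l₂ ∈ Set.Icc lmin lmax, ∀ β₁ τ₁ β₂ τ₂ : ℝ,
      StateEvo δ σ μ l₁ β₁ τ₁ → StateEvo δ σ μ l₂ β₂ τ₂ →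
      W2 (muStar μ τ₁ (l₁ / β₁)) (muStar μ τ₂ (l₂ / β₂)) ≤ M * |l₁ - l₂| := by
  obtain ⟨T, hT⟩ := exists_tau_le (lmax := lmax) hδ hσ hlmin hα hK hε hrisk
  obtain ⟨m, hm, hβ⟩ := exists_le_beta (lmax := lmax) hδ hσ hlmin hK hεδ
  refine ⟨(max T 1) ^ 3 / (m * σ ^ 2), by positivity,
    fun μ _ hμ hμε l₁ hl₁ l₂ hl₂ β₁ τ₁ β₂ τ₂ h₁ h₂ => ?_⟩
  have hl₁0 := hlmin.trans_le hl₁.1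
  have hl₂0 := hlmin.trans_le hl₂.1
  have hβ₁ := h₁.1
  have hτ₁ := h₁.2.1
  have hβ₂ := h₂.1
  have hτ₂ := h₂.2.1
  have hb₁ : 0 < τ₁ * l₁ / β₁ := by positivity
  have hb₂ : 0 < τ₂ * l₂ / β₂ := by positivity
  have hw₁ := memLp_shrinkErr hμ hb₁.le τ₁
  have hw₂ := memLp_shrinkErr hμ hb₂.le τ₂
  have hS₁ := memLp_shrinkSubgrad (μ := μ) hb₁ τ₁
  have hS₂ := memLp_shrinkSubgrad (μ := μ) hb₂ τ₂
  have hd : ‖hw₁.toLp _ - hw₂.toLp _‖ ≤ (max T 1) ^ 3 / (m * σ ^ 2) * |l₁ - l₂| := by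
    refine norm_sub_le_of_stationary hδ hσ hl₁0 hτ₁ hτ₂ hm
      (hβ μ hμε l₁ hl₁ β₁ τ₁ h₁) (hβ μ hμε l₂ hl₂ β₂ τ₂ h₂)
      ((hT μ hμ hμε l₁ hl₁ β₁ τ₁ h₁).trans (le_max_left _ _))
      ((hT μ hμ hμε l₂ hl₂ β₂ τ₂ h₂).trans (le_max_left _ _))
      (smul_shrinkSubgrad_eq hμ hl₁0 hβ₁ hτ₁ hb₁) (smul_shrinkSubgrad_eq hμ hl₂0 hβ₂ hτ₂ hb₂)
      ?_ ?_ ?_ ?_ ?_ (norm_toLp_le_one hS₂ (abs_shrinkSubgrad_le hb₂ τ₂))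
    · rw [norm_toLp_sq, h₁.integral_shrinkErr_sq hδ]
    · rw [norm_toLp_sq, h₂.integral_shrinkErr_sq hδ]
    · rw [inner_toLp_toLp, h₁.integral_snd_mul_shrinkErr hδ hl₁0 hμ]
    · rw [inner_toLp_toLp, h₂.integral_snd_mul_shrinkErr hδ hl₂0 hμ]
    · rw [← MemLp.toLp_sub, ← MemLp.toLp_sub, inner_toLp_toLp]
      exact integral_nonneg fun q => shrinkSubgrad_monotone hb₁ hb₂ τ₁ τ₂ q
  have e₁ : l₁ / β₁ * τ₁ = τ₁ * l₁ / β₁ := by ring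
  have e₂ : l₂ / β₂ * τ₂ = τ₂ * l₂ / β₂ := by ring
  refine (W2_muStar_le (e₁ ▸ hb₁.le) (e₂ ▸ hb₂.le)).trans ?_
  rw [e₁, e₂]
  refine le_trans (le_of_eq ?_) hd
  rw [← Real.sqrt_sq (norm_nonneg (hw₁.toLp _ - hw₂.toLp _)), ← MemLp.toLp_sub, norm_toLp_sq]
  rfl

end StateEvolution

section Empirical

variable {N : ℕ}

lemma isProbabilityMeasure_empDist (hN : 0 < N) (θ : Fin N → ℝ) :
    IsProbabilityMeasure (empDist θ) := by
  refine ⟨?_⟩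
  simp only [empDist, Measure.smul_apply, Measure.finsetSum_apply, measure_univ,
    Finset.sum_const, Finset.card_univ, Fintype.card_fin, nsmul_eq_mul, mul_one, smul_eq_mul]
  exact ENNReal.inv_mul_cancel (by exact_mod_cast hN.ne') (ENNReal.natCast_ne_top N)

lemma memLp_empDist (hN : 0 < N) (θ : Fin N → ℝ) : MemLp (fun x : ℝ => x) 2 (empDist θ) := by
  have := isProbabilityMeasure_empDist hN θ
  refine MemLp.of_bound aestronglyMeasurable_id (∑ i, |θ i|) ?_
  refine Measure.ae_smul_measure ?_ _
  rw [← Measure.sum_fintype, Measure.ae_sum_iff]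
  intro i
  rw [ae_dirac_eq]
  exact Finset.single_le_sum (f := fun i => |θ i|) (fun _ _ => abs_nonneg _) (Finset.mem_univ i)

lemma empDist_real_abs_gt (K : ℝ) (θ : Fin N → ℝ) :
    (empDist θ).real {x | K < |x|} = (Finset.univ.filter fun i => K < |θ i|).card / N := by
  have hm : MeasurableSet {x : ℝ | K < |x|} := measurableSet_lt measurable_const measurable_id.abs
  simp only [Measure.real, empDist, Measure.smul_apply, Measure.finsetSum_apply,
    Measure.dirac_apply' _ hm, smul_eq_mul]
  simp [Set.indicator_apply, div_eq_inv_mul]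

lemma empDist_real_abs_gt_le_of_mem_Fball {p ξ K ε : ℝ} (hN : 0 < N) (hp : 0 < p) (hK : 0 < K)
    (hKε : ξ ^ p ≤ ε * K ^ p) {θ : Fin N → ℝ} (hθ : θ ∈ Fball N p ξ) :
    (empDist θ).real {x | K < |x|} ≤ ε := by
  have hN' : (0 : ℝ) < N := by exact_mod_cast hN
  have hKp : 0 < K ^ p := Real.rpow_pos_of_pos hK p
  have hmarkov : ((Finset.univ.filter fun i => K < |θ i|).card : ℝ) * K ^ p
      ≤ ∑ i, |θ i| ^ p := by
    rw [← nsmul_eq_mul]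
    refine (Finset.card_nsmul_le_sum _ _ _ fun i hi => ?_).trans
      (Finset.sum_le_sum_of_subset_of_nonneg (Finset.filter_subset (fun i => K < |θ i|) _)
        fun i _ _ => Real.rpow_nonneg (abs_nonneg (θ i)) p)
    exact Real.rpow_le_rpow hK.le (Finset.mem_filter.1 hi).2.le hp.le
  have hsum : ∑ i, |θ i| ^ p ≤ ξ ^ p * N := by
    have h : 1 / (N : ℝ) * ∑ i, |θ i| ^ p ≤ ξ ^ p := hθ
    rwa [one_div, inv_mul_le_iff₀ hN', mul_comm] at h
  rw [empDist_real_abs_gt, div_le_iff₀ hN']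
  refine le_of_mul_le_mul_right ?_ hKp
  nlinarith

lemma empDist_real_abs_gt_le_of_mem_F0ball {s : ℝ} (hN : 0 < N) {θ : Fin N → ℝ}
    (hθ : θ ∈ F0ball N s) : (empDist θ).real {x | 0 < |x|} ≤ s := by
  have hN' : (0 : ℝ) < N := by exact_mod_cast hN
  rw [empDist_real_abs_gt, div_le_iff₀ hN']
  simpa only [abs_pos, F0ball, l0, Set.mem_ofPred_eq] using hθ

end Empirical

/-- Membership in the uniformity class bounds the mass of the large entries by a level at which
soft thresholding has minimax risk below `δ`. -/
lemma DFamSpec.exists_risk_lt {δ q : ℝ} {Dfam : (M : ℕ) → Set (Fin M → ℝ)}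
    (hD : DFamSpec δ Dfam q) (hδ : 0 < δ) :
    ∃ α K ε : ℝ, 0 ≤ α ∧ 0 ≤ K ∧ 0 ≤ ε ∧ ε < δ ∧
      nullRisk α + ε * (1 + α ^ 2 - nullRisk α) < δ ∧
      ∀ N, 0 < N → ∀ θ ∈ Dfam N, (empDist θ).real {x | K < |x|} ≤ ε := by
  rcases hD with ⟨p, ξ, hp, hξ, hD, -⟩ | ⟨s, hs0, hs, hD, -⟩
  · obtain ⟨α, hα, hα0⟩ := ((tendsto_nullRisk.eventually_lt_const (half_pos hδ)).and
      (Filter.eventually_ge_atTop 0)).exists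
    have hR := nullRisk_nonneg α
    set ε := δ / 2 / (1 + α ^ 2) with hε
    have hε0 : 0 < ε := by positivity
    have hεα : ε * (1 + α ^ 2) = δ / 2 := div_mul_cancel₀ _ (by positivity)
    refine ⟨α, ξ * ε ^ (-p⁻¹), ε, hα0, by positivity, hε0.le, by nlinarith [sq_nonneg α],
      by nlinarith, fun N hN θ hθ => ?_⟩
    refine empDist_real_abs_gt_le_of_mem_Fball hN hp (by positivity) (le_of_eq ?_) (hD N ▸ hθ)
    rw [Real.mul_rpow hξ.le (by positivity), ← Real.rpow_mul hε0.le, neg_mul,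
      inv_mul_cancel₀ hp.ne', Real.rpow_neg_one]
    field_simp
  · rw [smax, ← div_lt_iff₀' hδ] at hs
    obtain ⟨_, ⟨α, hα, rfl⟩, hlt⟩ := exists_lt_of_lt_csSup (Set.nonempty_Ici.image _) hs
    have hR := nullRisk_nonneg α
    have hR1 := nullRisk_le_one hα
    have e : 2 / δ * ((1 + α ^ 2) * gPhi (-α) - α * gphi α) = nullRisk α / δ := by
      rw [nullRisk_eq hα]
      ring
    simp only [e, ← nullRisk_eq hα] at hlt
    have hden : 0 < 1 + α ^ 2 - nullRisk α := by
      refine lt_of_le_of_ne (by nlinarith [sq_nonneg α]) fun h => ?_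
      rw [← h, div_zero] at hlt
      exact hlt.not_ge (by positivity)
    have hsR : s * (1 + α ^ 2 - nullRisk α) < δ - nullRisk α := by
      rw [lt_div_iff₀ hden, div_mul_eq_mul_div, one_sub_div hδ.ne',
        div_lt_div_iff_of_pos_right hδ] at hlt
      exact hlt
    have hmin : nullRisk α + min s 1 * (1 + α ^ 2 - nullRisk α) < δ := by
      nlinarith [min_le_left s 1]
    refine ⟨α, 0, min s 1, hα, le_rfl, le_min hs0 zero_le_one, ?_, hmin, fun N hN θ hθ => ?_⟩
    · nlinarith [min_le_right s 1, le_min hs0 zero_le_one, sq_nonneg α,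
        mul_nonneg (le_min hs0 zero_le_one) (sq_nonneg α)]
    · have := isProbabilityMeasure_empDist hN θ
      exact le_min (empDist_real_abs_gt_le_of_mem_F0ball hN (hD N ▸ hθ)) measureReal_le_one

/-- Proposition (Lipschitz continuity of λ ↦ μ⋆_λ in Wasserstein distance). -/
theorem stmt17 (δ σ lmin lmax q : ℝ)
    (hδ : 0 < δ) (hσ : 0 < σ) (hl : 0 < lmin) (hll : lmin ≤ lmax)
    (Dfam : (M : ℕ) → Set (Fin M → ℝ))
    (hD : DFamSpec δ Dfam q) :
    ∃ M : ℝ, 0 < M ∧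
      ∀ (N n : ℕ), 0 < N → (n : ℝ) = δ * N →
      ∀ θstar ∈ Dfam N,
      ∀ lam1 ∈ Set.Icc lmin lmax, ∀ lam2 ∈ Set.Icc lmin lmax,
      ∀ β1 τ1 β2 τ2 : ℝ,
      StateEvo δ σ (empDist θstar) lam1 β1 τ1 →
      StateEvo δ σ (empDist θstar) lam2 β2 τ2 →
      W2 (muStar (empDist θstar) τ1 (lam1 / β1))
          (muStar (empDist θstar) τ2 (lam2 / β2))
        ≤ M * |lam1 - lam2| := by
  obtain ⟨α, K, ε, hα, hK, hε, hεδ, hrisk, hmass⟩ := hD.exists_risk_lt hδ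
  obtain ⟨M, hM, hLip⟩ :=
    exists_lipschitz_W2_muStar (lmax := lmax) hδ hσ hl hα hK hε hεδ hrisk
  refine ⟨M, hM, fun N n hN _ θstar hθ lam1 h1 lam2 h2 β1 τ1 β2 τ2 hs1 hs2 => ?_⟩
  have := isProbabilityMeasure_empDist hN θstar
  exact hLip (empDist θstar) (memLp_empDist hN θstar) (hmass N hN θstar hθ)
    lam1 h1 lam2 h2 β1 τ1 β2 τ2 hs1 hs2
end
end
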